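/- (Hölder stability for the Cauchy problem of a quasilinear elliptic system) Let Ω = {|x| < ρ} ⊂ ℝ³ and Ω_μ = {μ < |x| < ρ}. Let V₁, V₂ ∈ H²(Ω) ∩ C¹(Ω̄) be two solutions of ΔV = F(∇V) in Ω with Cauchy data on S_ρ = {|x| = ρ}: V₁|_{S_ρ} = p₀, V₂|_{S_ρ} = p_{0,δ}, ∂_r V₁|_{S_ρ} = p₁, ∂_r V₂|_{S_ρ} = p_{1,δ}, where ‖p_{0,δ} − p₀‖_{L²(S_ρ)} ≤ δ and ‖p_{1,δ} − p₁‖_{L²(S_ρ)} ≤ δ, and ‖V₁‖_{C¹(Ω̄)}, ‖V₂‖_{C¹(Ω̄)} ≤ A. Fix η ∈ (0, ρ−μ) and set Ω_{μ+η} = {μ+η < |x| < ρ}. Then there exist C₁ > 0 and δ₀ ∈ (0,1), depending only on Ω_μ, η, F, and A, such that for all δ ∈ (0,δ₀): ‖V₁ − V₂‖_{H¹(Ω_{μ+η})} ≤ C₁ δ^{η/(4ρ)}. -/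

import Mathlib

open MeasureTheory Real

noncomputable section

/-- The Laplacian `Δf = ∑ᵢ ∂²f/∂xᵢ²` on `ℝ³`. -/
def lap (f : EuclideanSpace ℝ (Fin 3) → ℝ) (x : EuclideanSpace ℝ (Fin 3)) : ℝ :=
  ∑ i : Fin 3,
    fderiv ℝ (fun y => fderiv ℝ f y (EuclideanSpace.single i 1)) x (EuclideanSpace.single i 1)

/-- The radial derivative `w_r = ∂w/∂r = ∇w · x/|x|`. -/
def radialDeriv (f : EuclideanSpace ℝ (Fin 3) → ℝ) (x : EuclideanSpace ℝ (Fin 3)) : ℝ :=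
  fderiv ℝ f x (‖x‖⁻¹ • x)

/-- The spherical annulus `{a < |x| < b}` in `ℝ³`. -/
def annulus (a b : ℝ) : Set (EuclideanSpace ℝ (Fin 3)) := {x | a < ‖x‖ ∧ ‖x‖ < b}

/-- `F` is a quadratic vector function of the gradient entries. -/
def IsQuadratic (N : ℕ) (F : (Fin N → EuclideanSpace ℝ (Fin 3)) → (Fin N → ℝ)) : Prop :=
  ∃ (B : (Fin N → EuclideanSpace ℝ (Fin 3)) →ₗ[ℝ]
        (Fin N → EuclideanSpace ℝ (Fin 3)) →ₗ[ℝ] (Fin N → ℝ))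
    (L : (Fin N → EuclideanSpace ℝ (Fin 3)) →ₗ[ℝ] (Fin N → ℝ)) (c : Fin N → ℝ),
    ∀ y, F y = B y y + L y + c

local notation "E3" => EuclideanSpace ℝ (Fin 3)
local notation "S2" => Metric.sphere (0 : EuclideanSpace ℝ (Fin 3)) 1
local notation "σ" => Measure.toSphere (volume : Measure (EuclideanSpace ℝ (Fin 3)))

open scoped Pointwise in
lemma toSphere_le_of_dist_le {t : Set S2} (ht : MeasurableSet t) {ε : ℝ} (hε : 0 < ε)
    (hε1 : ε ≤ 1) (hd : ∀ x ∈ t, ∀ y ∈ t, dist x y ≤ ε) :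
    (σ).real t ≤ 24 * volume.real (Metric.closedBall (0 : E3) 1) * ε ^ 2 := by
  rcases t.eq_empty_or_nonempty with rfl | ⟨x₀, hx₀⟩
  · simp; positivity
  set X : Set E3 := Set.Ioo (0 : ℝ) 1 • ((↑) '' t) with hX
  have hXb : X ⊆ Metric.closedBall 0 1 := by
    rintro _ ⟨s, hs, _, ⟨y, hy, rfl⟩, rfl⟩
    simp [norm_smul, abs_of_pos hs.1, hs.2.le]
  have hXfin : volume X ≠ ⊤ :=
    ((measure_mono hXb).trans_lt measure_closedBall_lt_top).ne
  have hσ : (σ).real t = 3 * volume.real X := by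
    simp [Measure.real, Measure.toSphere_apply' _ ht, hX]
  have hsub : X ⊆ ((1 - ε) • X) ∪ Metric.closedBall (x₀ : E3) (2 * ε) := by
    rintro _ ⟨s, hs, _, ⟨y, hy, rfl⟩, rfl⟩
    by_cases h : s < 1 - ε
    · left
      have h1 : 0 < 1 - ε := hs.1.trans h
      refine ⟨(s / (1 - ε)) • (y : E3),
          ⟨_, ⟨by have := hs.1; positivity, ?_⟩, _, ⟨y, hy, rfl⟩, rfl⟩, ?_⟩
      · rwa [div_lt_one h1]
      · simp only [smul_smul]
        rw [mul_div_cancel₀ _ h1.ne']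
    · right
      have h1 : dist (y : E3) x₀ ≤ ε := hd y hy x₀ hx₀
      have h2 : dist (s • (y : E3)) y ≤ ε := by
        have : s • (y : E3) - y = (s - 1) • (y : E3) := by rw [sub_smul, one_smul]
        rw [dist_eq_norm, this, norm_smul]
        have := hs.2
        simp [abs_of_neg (sub_neg.2 this)]
        linarith
      simp only [Metric.mem_closedBall]
      linarith [dist_triangle (s • (y : E3)) y x₀]
  have h1 : volume.real X ≤ (1 - ε) ^ 3 * volume.real X
      + (2 * ε) ^ 3 * volume.real (Metric.closedBall (0 : E3) 1) := by
    have e1 : volume.real ((1 - ε) • X) = (1 - ε) ^ 3 * volume.real X := by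
      have h0 : 0 ≤ (1 - ε) ^ 3 := pow_nonneg (by linarith) 3
      simp [Measure.real, Measure.addHaar_smul, abs_of_nonneg (sub_nonneg.2 hε1), h0]
    have e2 : volume.real (Metric.closedBall (x₀ : E3) (2 * ε))
        = (2 * ε) ^ 3 * volume.real (Metric.closedBall (0 : E3) 1) := by
      rw [Measure.addHaar_real_closedBall _ _ (by positivity),
        Measure.addHaar_real_closedBall _ 0 zero_le_one]
      simp
    rw [← e1, ← e2]
    refine (measureReal_mono hsub ?_).trans (measureReal_union_le _ _)
    refine (measure_union_lt_top ?_ measure_closedBall_lt_top).ne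
    rw [Measure.addHaar_smul]
    exact ENNReal.mul_lt_top ENNReal.ofReal_lt_top hXfin.lt_top
  have h2 : 0 ≤ volume.real X := measureReal_nonneg
  have h3 : ε * volume.real X ≤ ε * (8 * ε ^ 2 * volume.real (Metric.closedBall (0 : E3) 1)) := by
    have : ε ≤ 1 - (1 - ε) ^ 3 := by nlinarith [mul_nonneg hε.le (sub_nonneg.2 hε1)]
    nlinarith
  have := le_of_mul_le_mul_left h3 hε
  rw [hσ]; linarith

lemma sphere_measure_le_hausdorff {ρ : ℝ} (hρ : 0 < ρ) :
    ∃ C : ℝ, 0 < C ∧ (σ).map (fun ω : S2 => ρ • (ω : E3)) ≤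
      ENNReal.ofReal C • (μH[2]).restrict (Metric.sphere (0 : E3) ρ) := by
  set c : ℝ := 24 * volume.real (Metric.closedBall (0 : E3) 1) * ρ⁻¹ ^ 2 + 1 with hc
  have hc0 : 0 < c := by positivity
  have hm : Measurable (fun ω : S2 => ρ • (ω : E3)) := by fun_prop
  refine ⟨c, hc0, ?_⟩
  set ν := (σ).map (fun ω : S2 => ρ • (ω : E3)) with hν
  have hcC : ENNReal.ofReal c ≠ 0 := by simpa using hc0
  have key : (ENNReal.ofReal c)⁻¹ • ν ≤ μH[2] := by
    refine Measure.le_hausdorffMeasure 2 _ (ENNReal.ofReal (ρ / 2)) (by simpa using hρ) ?_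
    intro s hs
    have hfin : Metric.ediam s ≠ ⊤ := (hs.trans_lt ENNReal.ofReal_lt_top).ne
    have hd : Metric.diam s ≤ ρ / 2 := ENNReal.toReal_le_of_le_ofReal (by positivity) hs
    have hbd : Bornology.IsBounded s := Metric.isBounded_iff_ediam_ne_top.2 hfin
    have step : ∀ d, Metric.diam s < d → d ≤ ρ → (ν s).toReal ≤ c * d ^ 2 := by
      intro d hd1 hd2
      have hd0 : 0 < d := Metric.diam_nonneg.trans_lt hd1
      have hmeas : MeasurableSet ((fun ω : S2 => ρ • (ω : E3)) ⁻¹' closure s) :=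
        hm isClosed_closure.measurableSet
      have := toSphere_le_of_dist_le hmeas (ε := d / ρ) (by positivity)
        ((div_le_one hρ).2 hd2) (by
          intro x hx y hy
          have h1 := Metric.dist_le_diam_of_mem hbd.closure hx hy
          rw [Metric.diam_closure] at h1
          simp only [dist_smul₀, Real.norm_eq_abs, abs_of_pos hρ] at h1
          rw [le_div_iff₀ hρ, Subtype.dist_eq]
          linarith)
      have h2 : (ν s).toReal ≤ (σ).real ((fun ω : S2 => ρ • (ω : E3)) ⁻¹' closure s) := by
        refine ENNReal.toReal_mono (measure_ne_top _ _) ?_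
        rw [← Measure.map_apply hm isClosed_closure.measurableSet]
        exact measure_mono subset_closure
      refine h2.trans (this.trans ?_)
      rw [hc, div_pow, inv_pow, div_eq_mul_inv]
      nlinarith [sq_nonneg d]
    have hle : (ν s).toReal ≤ c * Metric.diam s ^ 2 := by
      have hcont : Filter.Tendsto (fun d : ℝ => c * d ^ 2)
          (nhdsWithin (Metric.diam s) (Set.Ioi (Metric.diam s)))
          (nhds (c * Metric.diam s ^ 2)) :=
        (Continuous.tendsto (by fun_prop) _).mono_left nhdsWithin_le_nhds
      refine ge_of_tendsto hcont ?_
      have hlt : Metric.diam s < ρ := by linarith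
      filter_upwards [Ioc_mem_nhdsGT hlt] with d hd
      exact step d hd.1 hd.2
    have hνfin : ν s ≠ ⊤ := by
      have : IsFiniteMeasure ν := by rw [hν]; infer_instance
      exact measure_ne_top _ _
    have hed : Metric.ediam s = ENNReal.ofReal (Metric.diam s) := (ENNReal.ofReal_toReal hfin).symm
    rw [Measure.smul_apply, smul_eq_mul, ← ENNReal.div_eq_inv_mul]
    refine ENNReal.div_le_of_le_mul ?_
    rw [hed, show (2 : ℝ) = ((2 : ℕ) : ℝ) by norm_num, ENNReal.rpow_natCast,
      ← ENNReal.ofReal_pow Metric.diam_nonneg, ← ENNReal.ofReal_mul (by positivity), mul_comm,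
      ← ENNReal.ofReal_toReal hνfin]
    exact ENNReal.ofReal_le_ofReal hle
  have hres : ν.restrict (Metric.sphere (0 : E3) ρ) = ν := by
    refine Measure.restrict_eq_self_of_ae_mem ?_
    rw [hν]
    refine (ae_map_iff hm.aemeasurable Metric.isClosed_sphere.measurableSet).2 ?_
    exact .of_forall fun ω => by simp [norm_smul, abs_of_pos hρ]
  calc ν = ENNReal.ofReal c • ((ENNReal.ofReal c)⁻¹ • ν).restrict (Metric.sphere (0 : E3) ρ) := by
        rw [Measure.restrict_smul, smul_smul, ENNReal.mul_inv_cancel hcC ENNReal.ofReal_ne_top,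
            one_smul, hres]
    _ ≤ _ := by
        gcongr

lemma hausdorffMeasure_sphere_lt_top (ρ : ℝ) :
    μH[2] (Metric.sphere (0 : E3) ρ) < ⊤ := by
  set g : (Fin 2 → ℝ) → E3 := fun a =>
    WithLp.toLp 2 ![ρ * (cos (a 0) * cos (a 1)), ρ * (cos (a 0) * sin (a 1)), ρ * sin (a 0)] with hg
  have hgc : ContDiff ℝ 1 g := by
    rw [contDiff_euclidean]
    intro i
    fin_cases i <;> simp [hg] <;> fun_prop
  set K : Set (Fin 2 → ℝ) := Set.Icc (fun _ => -4) (fun _ => 4) with hK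
  have hKc : IsCompact K := isCompact_Icc
  obtain ⟨L, hL⟩ : ∃ L, LipschitzOnWith L g K :=
    hgc.contDiffOn.exists_lipschitzOnWith one_ne_zero (convex_Icc _ _) hKc
  have hsub : Metric.sphere (0 : E3) ρ ⊆ g '' K := by
    intro x hx
    have hx' : ‖x‖ = ρ := by simpa using hx
    have hnn : 0 ≤ ρ := hx' ▸ norm_nonneg x
    have hs : x 0 ^ 2 + x 1 ^ 2 + x 2 ^ 2 = ρ ^ 2 := by
      rw [← hx', EuclideanSpace.norm_sq_eq]; simp [Fin.sum_univ_three]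
    set z : ℂ := ⟨x 0, x 1⟩ with hz
    set a := Complex.arg ⟨‖z‖, x 2⟩ with ha
    have hn : ‖z‖ ^ 2 = x 0 ^ 2 + x 1 ^ 2 := by
      rw [Complex.sq_norm, Complex.normSq_apply]; simp [hz]; ring
    have hn2 : ‖(⟨‖z‖, x 2⟩ : ℂ)‖ = ρ := by
      rw [← sq_eq_sq₀ (norm_nonneg _) hnn, Complex.sq_norm, Complex.normSq_apply]
      simp only; nlinarith
    have e1 : ρ * cos a = ‖z‖ := by
      have := Complex.norm_mul_cos_arg ⟨‖z‖, x 2⟩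
      rwa [hn2] at this
    have e2 : ρ * sin a = x 2 := by
      have := Complex.norm_mul_sin_arg ⟨‖z‖, x 2⟩
      rwa [hn2] at this
    have e3 : ‖z‖ * cos z.arg = x 0 := Complex.norm_mul_cos_arg z
    have e4 : ‖z‖ * sin z.arg = x 1 := Complex.norm_mul_sin_arg z
    refine ⟨![a, z.arg], ?_, ?_⟩
    · have hb : ∀ w : ℂ, -4 ≤ w.arg ∧ w.arg ≤ 4 := fun w =>
        ⟨by linarith [Complex.neg_pi_lt_arg w, pi_le_four],
          by linarith [Complex.arg_le_pi w, pi_le_four]⟩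
      rw [hK, Set.mem_Icc, Pi.le_def, Pi.le_def]
      exact ⟨fun i => by fin_cases i <;> simp [(hb _).1, ha],
        fun i => by fin_cases i <;> simp [(hb _).2, ha]⟩
    · ext i
      fin_cases i
      · simp [hg]; rw [← mul_assoc, e1, e3]
      · simp [hg]; rw [← mul_assoc, e1, e4]
      · simp [hg]; rw [e2]
  have h2 := hL.hausdorffMeasure_image_le (d := 2) (by norm_num)
  refine (measure_mono hsub).trans_lt (h2.trans_lt ?_)
  refine ENNReal.mul_lt_top (by simp) ?_
  have : (μH[2] : Measure (Fin 2 → ℝ)) = volume := by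
    have := hausdorffMeasure_pi_real (ι := Fin 2)
    simpa using this
  rw [this]
  exact hKc.measure_lt_top

lemma integral_sphere_le_hausdorff {ρ : ℝ} (hρ : 0 < ρ) :
    ∃ C : ℝ, 0 < C ∧ ∀ f : E3 → ℝ, Continuous f → (∀ x, 0 ≤ f x) →
      ∫ ω : S2, f (ρ • (ω : E3)) ∂σ ≤ C * ∫ x in Metric.sphere (0 : E3) ρ, f x ∂(μH[2]) := by
  obtain ⟨C, hC, h⟩ := sphere_measure_le_hausdorff hρ
  refine ⟨C, hC, fun f hf hf0 => ?_⟩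
  have hm : Measurable (fun ω : S2 => ρ • (ω : E3)) := by fun_prop
  rw [← integral_map (f := f) hm.aemeasurable hf.aestronglyMeasurable]
  have hint : Integrable f ((μH[2]).restrict (Metric.sphere (0 : E3) ρ)) := by
    have hcomp : IsCompact (Metric.sphere (0 : E3) ρ) := isCompact_sphere _ _
    obtain ⟨B, hB⟩ := hcomp.exists_bound_of_continuousOn hf.continuousOn
    exact IntegrableOn.of_bound (hausdorffMeasure_sphere_lt_top ρ) hf.aestronglyMeasurable B
      ((ae_restrict_iff' hcomp.measurableSet).2 (.of_forall hB))
  have h1 := integral_mono_measure h (.of_forall hf0) (hint.smul_measure ENNReal.ofReal_ne_top)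
  rwa [integral_smul_measure, ENNReal.toReal_ofReal hC.le, smul_eq_mul] at h1

lemma setIntegral_annulus_eq_polar {a b : ℝ} (ha : 0 ≤ a) {f : E3 → ℝ} (hf : Continuous f) :
    ∫ x in annulus a b, f x = ∫ r in Set.Ioo a b, r ^ 2 * ∫ ω : S2, f (r • (ω : E3)) ∂σ := by
  have hmeas : MeasurableSet (annulus a b) :=
    (measurableSet_lt measurable_const measurable_norm).inter
      (measurableSet_lt measurable_norm measurable_const)
  have hint : IntegrableOn f (annulus a b) := by
    refine (hf.continuousOn.integrableOn_compact (isCompact_closedBall (0 : E3) b)).mono_set ?_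
    rintro x ⟨-, hx⟩
    simpa using hx.le
  set g := (annulus a b).indicator f with hg
  have hgi : Integrable g := (integrable_indicator_iff hmeas).2 hint
  have mp := (volume : Measure E3).measurePreserving_homeomorphUnitSphereProd
  have hemb := (homeomorphUnitSphereProd E3).measurableEmbedding
  set h : S2 × Set.Ioi (0 : ℝ) → ℝ := fun p => g ((p.2 : ℝ) • (p.1 : E3)) with hh
  have hcomp : ∀ x : ({0}ᶜ : Set E3), h (homeomorphUnitSphereProd E3 x) = g x := by
    intro x
    simp only [hh]
    congr 1
    exact congrArg Subtype.val ((homeomorphUnitSphereProd E3).symm_apply_apply x)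
  have hhi : Integrable h ((σ).prod (Measure.volumeIoiPow (Module.finrank ℝ E3 - 1))) := by
    rw [← mp.integrable_comp_emb hemb]
    have : h ∘ (homeomorphUnitSphereProd E3) = g ∘ Subtype.val := funext hcomp
    rw [this]
    refine (integrableOn_iff_comap_subtypeVal (measurableSet_singleton (0 : E3)).compl).1
        hgi.integrableOn
  have e1 : ∫ x in annulus a b, f x
      = ∫ p, h p ∂((σ).prod (Measure.volumeIoiPow (Module.finrank ℝ E3 - 1))) := by
    rw [← integral_indicator hmeas, ← hg, ← mp.integral_comp hemb]
    simp only [hcomp]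
    rw [integral_subtype_comap (measurableSet_singleton (0 : E3)).compl g, restrict_compl_singleton]
  rw [e1, integral_prod_symm _ hhi, Measure.volumeIoiPow]
  simp only [ENNReal.ofReal]
  rw [integral_withDensity_eq_integral_smul
    ((measurable_subtype_coe.pow_const _).real_toNNReal),
    integral_subtype_comap measurableSet_Ioi fun r => Real.toNNReal (r ^ (Module.finrank ℝ E3 - 1))
        •
      ∫ ω : S2, g (r • (ω : E3)) ∂σ]
  have e2 : ∀ r ∈ Set.Ioi (0 : ℝ), (Real.toNNReal (r ^ (Module.finrank ℝ E3 - 1)) •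
      ∫ ω : S2, g (r • (ω : E3)) ∂σ)
      = (Set.Ioo a b).indicator (fun r => r ^ 2 * ∫ ω : S2, f (r • (ω : E3)) ∂σ) r := by
    intro r hr
    have hr0 : (0 : ℝ) < r := hr
    have hmem : ∀ ω : S2, r • (ω : E3) ∈ annulus a b ↔ r ∈ Set.Ioo a b := fun ω => by
      simp [annulus, norm_smul, abs_of_pos hr0]
    rw [NNReal.smul_def, Real.coe_toNNReal _ (pow_nonneg hr0.le _)]
    by_cases hrab : r ∈ Set.Ioo a b
    · rw [Set.indicator_of_mem hrab]
      simp [hg, Set.indicator_of_mem, (hmem _).2 hrab]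
    · rw [Set.indicator_of_notMem hrab]
      simp [hg, Set.indicator_of_notMem, mt (hmem _).1 hrab]
  rw [setIntegral_congr_fun measurableSet_Ioi e2, setIntegral_indicator measurableSet_Ioo]
  congr 2
  ext r
  simp only [Set.mem_inter_iff, Set.mem_Ioi, Set.mem_Ioo]
  exact ⟨fun h => h.2, fun h => ⟨ha.trans_lt h.1, h⟩⟩

lemma continuous_sphere_integral {f : ℝ → S2 → ℝ} (hf : Continuous (Function.uncurry f)) :
    Continuous fun x => ∫ ω, f x ω ∂σ := by
  simpa using continuous_parametric_integral_of_continuous (μ := σ) hf isCompact_univ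

lemma hasDerivAt_sphere_integral {f f' : ℝ → S2 → ℝ} (hf : Continuous (Function.uncurry f))
    (hf' : Continuous (Function.uncurry f')) (h : ∀ r ω, HasDerivAt (fun s => f s ω) (f' r ω) r)
    (r : ℝ) : HasDerivAt (fun s => ∫ ω, f s ω ∂σ) (∫ ω, f' r ω ∂σ) r := by
  have hK : IsCompact (Set.Icc (r - 1) (r + 1) ×ˢ (Set.univ : Set S2)) :=
    isCompact_Icc.prod isCompact_univ
  obtain ⟨B, hB⟩ := hK.exists_bound_of_continuousOn hf'.continuousOn
  have hc : ∀ {g : ℝ → S2 → ℝ} (_ : Continuous (Function.uncurry g)) (s : ℝ),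
      Continuous (g s) := fun hg s => hg.comp (by fun_prop : Continuous fun ω => (s, ω))
  refine (hasDerivAt_integral_of_dominated_loc_of_deriv_le (bound := fun _ => B)
    (s := Set.Ioo (r - 1) (r + 1))
    (Ioo_mem_nhds (by linarith) (by linarith))
    (.of_forall fun s => (hc hf s).aestronglyMeasurable)
    ((hc hf r).integrable_of_hasCompactSupport (HasCompactSupport.of_compactSpace _))
    (hc hf' r).aestronglyMeasurable
    (.of_forall fun ω s hs => hB (s, ω) ⟨Set.Ioo_subset_Icc_self hs, trivial⟩)
    (integrable_const _)
    (.of_forall fun ω s _ => h s ω)).2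

open scoped Pointwise in
lemma integral_sphere_comp_isometry (R : E3 ≃ₗᵢ[ℝ] E3) {f : E3 → ℝ} (hf : Continuous f) :
    ∫ ω : S2, f (R ω) ∂σ = ∫ ω : S2, f ω ∂σ := by
  set T : S2 → S2 := fun ω => ⟨R ω, by simp⟩ with hT
  have hTm : Measurable T := by
    have : Continuous T := Continuous.subtype_mk (R.continuous.comp continuous_subtype_val) _
    exact this.measurable
  have hmp : MeasurePreserving T σ σ := by
    refine ⟨hTm, Measure.ext fun s hs => ?_⟩
    rw [Measure.map_apply hTm hs, Measure.toSphere_apply' _ hs,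
      Measure.toSphere_apply' _ (hTm hs),
      ← R.measurePreserving.measure_preimage_emb R.toHomeomorph.measurableEmbedding
        (Set.Ioo (0 : ℝ) 1 • (Subtype.val '' s))]
    congr 2
    ext x
    simp only [Set.mem_smul, Set.mem_image, Set.mem_preimage]
    constructor
    · rintro ⟨c, hc, _, ⟨ω, hω, rfl⟩, rfl⟩
      exact ⟨c, hc, R ω, ⟨T ω, hω, rfl⟩, by simp⟩
    · rintro ⟨c, hc, _, ⟨ω, hω, rfl⟩, hx⟩
      refine ⟨c, hc, _, ⟨⟨R.symm ω, by simp⟩, ?_, rfl⟩, ?_⟩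
      · simpa [hT] using hω
      · rw [← R.symm_apply_apply x, ← hx, map_smul]
  have := integral_map (μ := σ) hTm.aemeasurable (f := fun ω : S2 => f ω)
    (hf.comp continuous_subtype_val).aestronglyMeasurable
  rw [hmp.map_eq] at this
  exact this.symm

/-- The rotation by the angle `t` in the plane spanned by the `i`-th and `j`-th basis vectors. -/
def planeRotation (i j : Fin 3) (t : ℝ) (x : E3) : E3 :=
  x + (cos t - 1) • (x i • EuclideanSpace.single i (1 : ℝ) + x j • EuclideanSpace.single j (1 : ℝ))
    + sin t • (x i • EuclideanSpace.single j (1 : ℝ) - x j • EuclideanSpace.single i (1 : ℝ))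

lemma norm_planeRotation {i j : Fin 3} (hij : i ≠ j) (t : ℝ) (x : E3) :
    ‖planeRotation i j t x‖ = ‖x‖ := by
  rw [← sq_eq_sq₀ (norm_nonneg _) (norm_nonneg _), EuclideanSpace.norm_sq_eq,
    EuclideanSpace.norm_sq_eq]
  have := sin_sq_add_cos_sq t
  fin_cases i <;> fin_cases j <;> simp [planeRotation, Fin.sum_univ_three] at hij ⊢ <;> grind

lemma exists_isometry_planeRotation {i j : Fin 3} (hij : i ≠ j) (t : ℝ) :
    ∃ R : E3 ≃ₗᵢ[ℝ] E3, ∀ x, R x = planeRotation i j t x := by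
  let L : E3 →ₗᵢ[ℝ] E3 :=
    { toFun := planeRotation i j t
      map_add' := fun x y => by
        simp only [planeRotation, PiLp.add_apply]; module
      map_smul' := fun c x => by
        simp only [planeRotation, PiLp.smul_apply, smul_eq_mul, RingHom.id_apply]; module
      norm_map' := norm_planeRotation hij t }
  exact ⟨L.toLinearIsometryEquiv rfl, fun x => rfl⟩

lemma integral_sphere_rotation_generator {f : E3 → ℝ} (hf : ContDiff ℝ 1 f) (i j : Fin 3) (r : ℝ) :
    (∫ ω : S2, fderiv ℝ f (r • (ω : E3)) ((ω : E3) i • EuclideanSpace.single j (1 : ℝ)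
      - (ω : E3) j • EuclideanSpace.single i (1 : ℝ)) ∂σ) * r = 0 := by
  rcases eq_or_ne i j with rfl | hij
  · simp
  set g : ℝ → S2 → ℝ := fun t ω => f (r • planeRotation i j t ω) with hg
  set v : ℝ → S2 → E3 := fun t ω =>
      (-sin t) • ((ω : E3) i • EuclideanSpace.single i (1 : ℝ) + (ω : E3) j • EuclideanSpace.single
          j (1 : ℝ))
      + cos t • ((ω : E3) i • EuclideanSpace.single j (1 : ℝ) - (ω : E3) j • EuclideanSpace.single
          i (1 : ℝ)) with hv
  have hpc : Continuous fun p : ℝ × S2 => planeRotation i j p.1 p.2 := by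
    unfold planeRotation; fun_prop
  have hvc : Continuous fun p : ℝ × S2 => v p.1 p.2 := by
    simp only [hv]; fun_prop
  have hfc : Continuous (fderiv ℝ f) := hf.continuous_fderiv one_ne_zero
  have hd : ∀ t ω, HasDerivAt (fun s => g s ω) (fderiv ℝ f (r • planeRotation i j t ω) (r • v t ω))
      t := by
    intro t ω
    have h1 : HasDerivAt (fun s => r • planeRotation i j s (ω : E3)) (r • v t ω) t := by
      unfold planeRotation
      simp only [hv]
      exact (((((hasDerivAt_cos t).sub_const 1).smul_const _).const_add _).add
        ((hasDerivAt_sin t).smul_const _)).const_smul r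
    exact ((hf.differentiable one_ne_zero _).hasFDerivAt).comp_hasDerivAt t h1
  have hD := hasDerivAt_sphere_integral (f := g)
    (f' := fun t ω => fderiv ℝ f (r • planeRotation i j t ω) (r • v t ω))
    (hf.continuous.comp (hpc.const_smul r))
    ((hfc.comp (hpc.const_smul r)).clm_apply (hvc.const_smul r)) hd 0
  have hconst : (fun s => ∫ ω, g s ω ∂σ) = fun _ => ∫ ω : S2, f (r • (ω : E3)) ∂σ := by
    funext s
    obtain ⟨R, hR⟩ := exists_isometry_planeRotation hij s
    have := integral_sphere_comp_isometry R (f := fun x => f (r • x))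
        (hf.continuous.comp (by fun_prop))
    simpa [hR, hg] using this
  rw [hconst] at hD
  have h0 := hD.unique (hasDerivAt_const _ _)
  rw [← h0, ← integral_mul_const]
  congr 1
  funext ω
  simp [hv, planeRotation, mul_comm]

lemma clm_apply_eq_sum (L : E3 →L[ℝ] ℝ) (x : E3) :
    L x = ∑ i, x i * L (EuclideanSpace.single i 1) := by
  conv_lhs => rw [← (EuclideanSpace.basisFun (Fin 3) ℝ).sum_repr x]
  simp

lemma clm_sub_sum_apply (L : Fin 3 → E3 →L[ℝ] ℝ) (y : Fin 3 → ℝ) (x : E3) (hx : ‖x‖ = 1) (r : ℝ) :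
    ∑ i, ∑ j, ((x i • EuclideanSpace.single j (1 : ℝ) - x j • EuclideanSpace.single i (1 : ℝ)) i *
        y j
      + r * x i * L j (x i • EuclideanSpace.single j (1 : ℝ) - x j • EuclideanSpace.single i
          (1 : ℝ)))
    = r * ∑ j, L j (EuclideanSpace.single j 1) - 2 * ∑ j, x j * y j - r * ∑ j, x j * L j x := by
  have hs : x 0 ^ 2 + x 1 ^ 2 + x 2 ^ 2 = 1 := by
    have := EuclideanSpace.norm_sq_eq x
    rw [hx] at this
    simpa [Fin.sum_univ_three] using this.symm
  simp only [fun j => clm_apply_eq_sum (L j) x]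
  simp only [Fin.sum_univ_three, map_sub, map_smul, smul_eq_mul]
  simp
  linear_combination (r * (L 0 (EuclideanSpace.single 0 1) + L 1 (EuclideanSpace.single 1 1)
    + L 2 (EuclideanSpace.single 2 1))) * hs

lemma integrable_sphere {f : S2 → ℝ} (hf : Continuous f) : Integrable f σ :=
  hf.integrable_of_hasCompactSupport (HasCompactSupport.of_compactSpace _)

/-- The integral over a sphere of the tangential divergence of a vector field, corrected by the
mean curvature term, vanishes. -/
lemma integral_sphere_tangential_divergence {X : Fin 3 → E3 → ℝ} (hX : ∀ j, ContDiff ℝ 1 (X j))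
    {r : ℝ} (hr : r ≠ 0) :
    ∫ ω : S2, (r * ∑ j, fderiv ℝ (X j) (r • (ω : E3)) (EuclideanSpace.single j 1)
      - 2 * ∑ j, (ω : E3) j * X j (r • (ω : E3))
      - r * ∑ j, (ω : E3) j * fderiv ℝ (X j) (r • (ω : E3)) ω) ∂σ = 0 := by
  have hc : ∀ i : Fin 3, ContDiff ℝ 1 (fun x : E3 => x i) := fun i => by fun_prop
  have hf : ∀ i j, ContDiff ℝ 1 (fun x : E3 => x i * X j x) := fun i j => (hc i).mul (hX j)
  have hfd : ∀ i j (x h : E3), fderiv ℝ (fun x : E3 => x i * X j x) x h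
      = h i * X j x + x i * fderiv ℝ (X j) x h := by
    intro i j x h
    have h1 : HasFDerivAt (fun x : E3 => x i) (EuclideanSpace.proj i : E3 →L[ℝ] ℝ) x :=
      (EuclideanSpace.proj i : E3 →L[ℝ] ℝ).hasFDerivAt
    have h2 := ((hX j).differentiable one_ne_zero x).hasFDerivAt
    rw [(h1.fun_mul h2).fderiv]
    simp; ring
  have h0 : ∀ i j, ∫ ω : S2, fderiv ℝ (fun x : E3 => x i * X j x) (r • (ω : E3))
      ((ω : E3) i • EuclideanSpace.single j (1 : ℝ) - (ω : E3) j • EuclideanSpace.single i (1 : ℝ))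
          ∂σ = 0 :=
    fun i j => (mul_eq_zero.1 (integral_sphere_rotation_generator (hf i j) i j r)).resolve_right hr
  have hi : ∀ i j, Integrable (fun ω : S2 => fderiv ℝ (fun x : E3 => x i * X j x) (r • (ω : E3))
      ((ω : E3) i • EuclideanSpace.single j (1 : ℝ) - (ω : E3) j • EuclideanSpace.single i
          (1 : ℝ))) σ := by
    intro i j
    refine integrable_sphere ?_
    exact (((hf i j).continuous_fderiv one_ne_zero).comp (by fun_prop)).clm_apply (by fun_prop)
  have hsum : ∫ ω : S2, ∑ i, ∑ j, fderiv ℝ (fun x : E3 => x i * X j x) (r • (ω : E3))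
      ((ω : E3) i • EuclideanSpace.single j (1 : ℝ) - (ω : E3) j • EuclideanSpace.single i (1 : ℝ))
          ∂σ = 0 := by
    rw [integral_finsetSum _ fun i _ => integrable_finsetSum _ fun j _ => hi i j]
    refine Finset.sum_eq_zero fun i _ => ?_
    rw [integral_finsetSum _ fun j _ => hi i j]
    exact Finset.sum_eq_zero fun j _ => h0 i j
  rw [← hsum]
  congr 1
  funext ω
  have := clm_sub_sum_apply (fun j => fderiv ℝ (X j) (r • (ω : E3))) (fun j => X j (r • (ω : E3)))
    ω (by simp) r
  rw [← this]
  simp only [hfd, PiLp.smul_apply, smul_eq_mul]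

/-- The first radial derivative of `w` in polar coordinates. -/
def radial₁ (w : E3 → ℝ) (r : ℝ) (ω : S2) : ℝ := fderiv ℝ w (r • (ω : E3)) ω

/-- The second radial derivative of `w` in polar coordinates. -/
def radial₂ (w : E3 → ℝ) (r : ℝ) (ω : S2) : ℝ := fderiv ℝ (fderiv ℝ w) (r • (ω : E3)) ω ω

/-- The squared norm of the tangential part of the gradient of `w`, in polar coordinates. -/
def tangentialSq (w : E3 → ℝ) (r : ℝ) (ω : S2) : ℝ :=
  ∑ j, fderiv ℝ w (r • (ω : E3)) (EuclideanSpace.single j 1) ^ 2 - radial₁ w r ω ^ 2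

/-- The radial derivative of `tangentialSq w`. -/
def tangentialSqDeriv (w : E3 → ℝ) (r : ℝ) (ω : S2) : ℝ :=
  2 * ∑ j, fderiv ℝ w (r • (ω : E3)) (EuclideanSpace.single j 1)
      * fderiv ℝ (fderiv ℝ w) (r • (ω : E3)) ω (EuclideanSpace.single j 1)
    - 2 * radial₁ w r ω * radial₂ w r ω

section Calculus

variable {w : E3 → ℝ}

lemma differentiable_fderiv_of_contDiff_two (hw : ContDiff ℝ 2 w) : Differentiable ℝ (fderiv ℝ w) :=
  (hw.fderiv_right (m := 1) le_rfl).differentiable one_ne_zero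

lemma fderiv_fderiv_apply_const (hw : ContDiff ℝ 2 w) (x v h : E3) :
    fderiv ℝ (fun y => fderiv ℝ w y v) x h = fderiv ℝ (fderiv ℝ w) x h v := by
  rw [fderiv_clm_apply (differentiable_fderiv_of_contDiff_two hw x) (by fun_prop)]
  simp

lemma lap_eq_sum_fderiv_fderiv (hw : ContDiff ℝ 2 w) (x : E3) :
    lap w x = ∑ i, fderiv ℝ (fderiv ℝ w) x (EuclideanSpace.single i 1)
        (EuclideanSpace.single i 1) := by
  simp only [lap, fderiv_fderiv_apply_const hw]

lemma contDiff_fderiv_apply (hw : ContDiff ℝ 2 w) (v : E3) : ContDiff ℝ 1 fun x => fderiv ℝ w x v :=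
  (hw.fderiv_right (m := 1) le_rfl).clm_apply contDiff_const

lemma continuous_radial₁ (hw : ContDiff ℝ 2 w) : Continuous (Function.uncurry (radial₁ w)) := by
  refine ((hw.continuous_fderiv two_ne_zero).comp ?_).clm_apply ?_ <;> fun_prop

lemma continuous_fderiv_fderiv (hw : ContDiff ℝ 2 w) : Continuous (fderiv ℝ (fderiv ℝ w)) :=
  (hw.fderiv_right (m := 1) le_rfl).continuous_fderiv one_ne_zero

lemma continuous_radial₂ (hw : ContDiff ℝ 2 w) : Continuous (Function.uncurry (radial₂ w)) := by
  refine (((continuous_fderiv_fderiv hw).comp ?_).clm_apply ?_).clm_apply ?_ <;> fun_prop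

lemma continuous_fderiv_polar (hw : ContDiff ℝ 2 w) (v : E3) :
    Continuous fun p : ℝ × S2 => fderiv ℝ w (p.1 • (p.2 : E3)) v :=
  ((hw.continuous_fderiv two_ne_zero).comp (by fun_prop)).clm_apply (by fun_prop)

lemma continuous_tangentialSq (hw : ContDiff ℝ 2 w) : Continuous
    (Function.uncurry (tangentialSq w)) := by
  have h1 := fun v => continuous_fderiv_polar hw v
  have h2 := continuous_radial₁ hw
  exact (continuous_finsetSum _ fun j _ => (h1 _).pow 2).sub (h2.pow 2)

lemma continuous_tangentialSqDeriv (hw : ContDiff ℝ 2 w) : Continuous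
    (Function.uncurry (tangentialSqDeriv w)) := by
  have h1 := fun v => continuous_fderiv_polar hw v
  have h2 := continuous_radial₁ hw
  have h3 := continuous_radial₂ hw
  refine (continuous_const.mul (continuous_finsetSum _ fun j _ => (h1 _).mul ?_)).sub
    ((continuous_const.mul h2).mul h3)
  refine (((continuous_fderiv_fderiv hw).comp ?_).clm_apply ?_).clm_apply ?_ <;> fun_prop

lemma continuous_lap (hw : ContDiff ℝ 2 w) : Continuous (lap w) := by
  rw [funext (lap_eq_sum_fderiv_fderiv hw)]
  exact continuous_finsetSum _ fun j _ =>
    ((continuous_fderiv_fderiv hw).clm_apply continuous_const).clm_apply continuous_const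

lemma hasDerivAt_polar (hw : ContDiff ℝ 2 w) (r : ℝ) (ω : S2) :
    HasDerivAt (fun s => w (s • (ω : E3))) (radial₁ w r ω) r := by
  have h1 : HasDerivAt (fun s : ℝ => s • (ω : E3)) (ω : E3) r := by
    simpa using (hasDerivAt_id r).smul_const (ω : E3)
  exact ((hw.differentiable two_ne_zero _).hasFDerivAt).comp_hasDerivAt r h1

lemma hasDerivAt_fderiv_polar (hw : ContDiff ℝ 2 w) (v : E3) (r : ℝ) (ω : S2) :
    HasDerivAt (fun s => fderiv ℝ w (s • (ω : E3)) v) (fderiv ℝ (fderiv ℝ w) (r • (ω : E3)) ω v)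
        r := by
  have h1 : HasDerivAt (fun s : ℝ => s • (ω : E3)) (ω : E3) r := by
    simpa using (hasDerivAt_id r).smul_const (ω : E3)
  have := (((contDiff_fderiv_apply hw v).differentiable one_ne_zero _).hasFDerivAt).comp_hasDerivAt
      r h1
  rwa [fderiv_fderiv_apply_const hw] at this

lemma hasDerivAt_radial₁ (hw : ContDiff ℝ 2 w) (r : ℝ) (ω : S2) :
    HasDerivAt (fun s => radial₁ w s ω) (radial₂ w r ω) r :=
  hasDerivAt_fderiv_polar hw _ r ω

lemma hasDerivAt_tangentialSq (hw : ContDiff ℝ 2 w) (r : ℝ) (ω : S2) :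
    HasDerivAt (fun s => tangentialSq w s ω) (tangentialSqDeriv w r ω) r := by
  have h1 := fun v => hasDerivAt_fderiv_polar hw v r ω
  have h2 := hasDerivAt_radial₁ hw r ω
  refine ((HasDerivAt.fun_sum fun j (_ : j ∈ Finset.univ) => (h1 (EuclideanSpace.single j 1)).pow
      2).sub
    (h2.pow 2)).congr_deriv ?_
  simp only [tangentialSqDeriv, Finset.mul_sum]
  congr 1
  · exact Finset.sum_congr rfl fun j _ => by norm_num; ring
  · norm_num

lemma integral_sphere_green_self (hw : ContDiff ℝ 2 w) {r : ℝ} (hr : r ≠ 0) :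
    ∫ ω : S2, (r * (tangentialSq w r ω
      + w (r • (ω : E3)) * (lap w (r • (ω : E3)) - radial₂ w r ω))
      - 2 * w (r • (ω : E3)) * radial₁ w r ω) ∂σ = 0 := by
  have hX : ∀ j : Fin 3, ContDiff ℝ 1 fun x => w x * fderiv ℝ w x (EuclideanSpace.single j 1) :=
    fun j => (hw.of_le one_le_two).mul (contDiff_fderiv_apply hw _)
  have hfd : ∀ (j : Fin 3) (x h : E3),
      fderiv ℝ (fun x => w x * fderiv ℝ w x (EuclideanSpace.single j 1)) x h
      = fderiv ℝ w x h * fderiv ℝ w x (EuclideanSpace.single j 1)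
        + w x * fderiv ℝ (fderiv ℝ w) x h (EuclideanSpace.single j 1) := by
    intro j x h
    rw [fderiv_fun_mul (hw.differentiable two_ne_zero x)
      ((contDiff_fderiv_apply hw _).differentiable one_ne_zero x)]
    simp [fderiv_fderiv_apply_const hw]; ring
  rw [← integral_sphere_tangential_divergence hX hr]
  congr 1
  funext ω
  simp only [hfd, lap_eq_sum_fderiv_fderiv hw, tangentialSq, radial₁, radial₂]
  have e1 := clm_apply_eq_sum (fderiv ℝ w (r • (ω : E3))) ω
  have e2 := clm_apply_eq_sum (fderiv ℝ (fderiv ℝ w) (r • (ω : E3)) ω) ω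
  simp only [Fin.sum_univ_three] at e1 e2 ⊢
  generalize fderiv ℝ w (r • (ω : E3)) ω = p at *
  generalize fderiv ℝ (fderiv ℝ w) (r • (ω : E3)) ω ω = q at *
  linear_combination (-r * p - 2 * w (r • (ω : E3))) * e1 - r * w (r • (ω : E3)) * e2

lemma integral_sphere_green_radial (hw : ContDiff ℝ 2 w) {r : ℝ} (hr : r ≠ 0) :
    ∫ ω : S2, (tangentialSq w r ω + r * tangentialSqDeriv w r ω / 2
      + r * radial₁ w r ω * (lap w (r • (ω : E3)) - radial₂ w r ω)
      - 2 * radial₁ w r ω ^ 2) ∂σ = 0 := by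
  have ha : ContDiff ℝ 1 fun x => fderiv ℝ w x x := (hw.fderiv_right (m := 1) le_rfl).clm_apply
      contDiff_id
  have hX : ∀ j : Fin 3, ContDiff ℝ 1 fun x => fderiv ℝ w x x * fderiv ℝ w x
      (EuclideanSpace.single j 1) :=
    fun j => ha.mul (contDiff_fderiv_apply hw _)
  have had : ∀ x h : E3, fderiv ℝ (fun x => fderiv ℝ w x x) x h
      = fderiv ℝ (fderiv ℝ w) x h x + fderiv ℝ w x h := by
    intro x h
    rw [fderiv_clm_apply (differentiable_fderiv_of_contDiff_two hw x) (by fun_prop)]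
    simp; ring
  have hfd : ∀ (j : Fin 3) (x h : E3),
      fderiv ℝ (fun x => fderiv ℝ w x x * fderiv ℝ w x (EuclideanSpace.single j 1)) x h
      = (fderiv ℝ (fderiv ℝ w) x h x + fderiv ℝ w x h) * fderiv ℝ w x (EuclideanSpace.single j 1)
        + fderiv ℝ w x x * fderiv ℝ (fderiv ℝ w) x h (EuclideanSpace.single j 1) := by
    intro j x h
    rw [fderiv_fun_mul (ha.differentiable one_ne_zero x)
      ((contDiff_fderiv_apply hw _).differentiable one_ne_zero x)]
    simp [fderiv_fderiv_apply_const hw, had]; ring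
  have hsymm : ∀ x v v' : E3, fderiv ℝ (fderiv ℝ w) x v v' = fderiv ℝ (fderiv ℝ w) x v' v :=
    fun x => (hw.contDiffAt (x := x)).isSymmSndFDerivAt (by simp)
  have key := integral_sphere_tangential_divergence hX hr
  suffices h : ∫ ω : S2, (tangentialSq w r ω + r * tangentialSqDeriv w r ω / 2
      + r * radial₁ w r ω * (lap w (r • (ω : E3)) - radial₂ w r ω)
      - 2 * radial₁ w r ω ^ 2) * r ∂σ = 0 by
    rw [integral_mul_const] at h
    exact (mul_eq_zero.1 h).resolve_right hr
  rw [← key]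
  congr 1
  funext ω
  simp only [hfd, lap_eq_sum_fderiv_fderiv hw, tangentialSq, tangentialSqDeriv, radial₁, radial₂]
  have e1 := clm_apply_eq_sum (fderiv ℝ w (r • (ω : E3))) ω
  have e2 := clm_apply_eq_sum (fderiv ℝ (fderiv ℝ w) (r • (ω : E3)) ω) ω
  have e3 := fun v => hsymm (r • (ω : E3)) (EuclideanSpace.single v 1) ω
  simp only [Fin.sum_univ_three, map_smul, smul_eq_mul, e3] at e1 e2 ⊢
  generalize fderiv ℝ w (r • (ω : E3)) ω = p at *
  generalize fderiv ℝ (fderiv ℝ w) (r • (ω : E3)) ω ω = q at *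
  linear_combination (-r * (r * q + p) - 2 * r * p) * e1 - r * r * p * e2

end Calculus

/-- The algebraic inequality behind the pointwise Carleman estimate. -/
lemma carleman_quadratic_le {l κ r E T u p v v' g : ℝ} (hl : 0 < l) (hκ : 0 < κ) (hr : 0 < r)
    (hT : 0 ≤ T) (hκr : κ * r ≤ 2) (hlκ : κ ≤ l) (hlr : 1 ≤ l * r) (hv : v = E * (r * u))
    (hv' : v' = E * (r * p + (1 + l * r) * u)) :
    -4 * l * v' * g - 8 * l ^ 2 * v' ^ 2 + l * κ * v' ^ 2 + l * κ * v * g - l ^ 3 * κ * v ^ 2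
      - (4 - κ * r) * l * E ^ 2 * r * T
    ≤ 2 * g ^ 2 - l * κ / 12 * (E * r * p) ^ 2 - l ^ 3 * κ / 12 * v ^ 2
      - l * κ / 12 * (E ^ 2 * r ^ 2 * T) := by
  have hp : E * r * p = v' - (l * v + E * u) := by rw [hv, hv']; ring
  have hEu : (E * u) ^ 2 ≤ (l * v) ^ 2 := by
    have : (l * v) ^ 2 = (l * r) ^ 2 * (E * u) ^ 2 := by rw [hv]; ring
    rw [this]
    exact le_mul_of_one_le_left (sq_nonneg _) (one_le_pow₀ hlr)
  have hp2 : (E * r * p) ^ 2 ≤ 3 * v' ^ 2 + 6 * (l * v) ^ 2 := by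
    rw [hp]
    linarith [sq_nonneg (v' + l * v), sq_nonneg (v' + E * u), sq_nonneg (l * v - E * u)]
  have h1 : -4 * l * v' * g ≤ g ^ 2 + 4 * (l ^ 2 * v' ^ 2) := by
    linarith [sq_nonneg (g + 2 * l * v')]
  have h2 : l * κ * v * g ≤ g ^ 2 + l ^ 2 * κ ^ 2 * v ^ 2 / 4 := by
    linarith [sq_nonneg (g - l * κ * v / 2)]
  have h3 : l * κ * v' ^ 2 ≤ l ^ 2 * v' ^ 2 := by
    have : l * κ ≤ l ^ 2 := by rw [sq]; gcongr
    gcongr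
  have h4 : l ^ 2 * κ ^ 2 * v ^ 2 ≤ l ^ 3 * κ * v ^ 2 := by
    have : l ^ 2 * κ ^ 2 ≤ l ^ 3 * κ := by
      calc l ^ 2 * κ ^ 2 = l ^ 2 * κ * κ := by ring
        _ ≤ l ^ 2 * κ * l := by gcongr
        _ = l ^ 3 * κ := by ring
    gcongr
  have h5 : l * κ / 12 * (E ^ 2 * r ^ 2 * T) ≤ (4 - κ * r) * l * E ^ 2 * r * T := by
    calc l * κ / 12 * (E ^ 2 * r ^ 2 * T) = κ * r / 12 * (l * E ^ 2 * r * T) := by ring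
      _ ≤ (4 - κ * r) * (l * E ^ 2 * r * T) :=
        mul_le_mul_of_nonneg_right (by linarith) (by positivity)
      _ = _ := by ring
  have h6 : l * κ / 12 * (E * r * p) ^ 2 ≤ l * κ * v' ^ 2 / 4 + l ^ 3 * κ * v ^ 2 / 2 := by
    calc l * κ / 12 * (E * r * p) ^ 2 ≤ l * κ / 12 * (3 * v' ^ 2 + 6 * (l * v) ^ 2) := by gcongr
      _ = _ := by ring
  have h7 : 0 ≤ l ^ 3 * κ * v ^ 2 := by positivity
  have h8 : 0 ≤ l ^ 2 * v' ^ 2 := by positivity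
  linarith

section Carleman

/-- The function `exp (l r) r w` whose spherical energy drives the Carleman estimate. -/
def conj₀ (l : ℝ) (w : E3 → ℝ) (r : ℝ) (ω : S2) : ℝ := exp (l * r) * (r * w (r • (ω : E3)))

/-- The radial derivative of `conj₀`. -/
def conj₁ (l : ℝ) (w : E3 → ℝ) (r : ℝ) (ω : S2) : ℝ :=
  exp (l * r) * (r * radial₁ w r ω + (1 + l * r) * w (r • (ω : E3)))

/-- The second radial derivative of `conj₀`. -/
def conj₂ (l : ℝ) (w : E3 → ℝ) (r : ℝ) (ω : S2) : ℝ :=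
  exp (l * r) * (r * radial₂ w r ω + 2 * (1 + l * r) * radial₁ w r ω
    + (2 * l + l ^ 2 * r) * w (r • (ω : E3)))

/-- The density of the Carleman energy on the sphere of radius `r`. -/
def energyDensity (l κ : ℝ) (w : E3 → ℝ) (r : ℝ) (ω : S2) : ℝ :=
  -2 * l * (conj₁ l w r ω ^ 2 + l ^ 2 * conj₀ l w r ω ^ 2)
    + l * κ * (conj₀ l w r ω * conj₁ l w r ω - l * conj₀ l w r ω ^ 2)
    + 2 * l * (exp (l * r) ^ 2 * r ^ 2 * tangentialSq w r ω)

/-- The radial derivative of `energyDensity`. -/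
def energyDensityDeriv (l κ : ℝ) (w : E3 → ℝ) (r : ℝ) (ω : S2) : ℝ :=
  -2 * l * (2 * conj₁ l w r ω * conj₂ l w r ω + l ^ 2 * (2 * conj₀ l w r ω * conj₁ l w r ω))
    + l * κ * (conj₁ l w r ω ^ 2 + conj₀ l w r ω * conj₂ l w r ω
      - l * (2 * conj₀ l w r ω * conj₁ l w r ω))
    + 2 * l * (exp (l * r) ^ 2 * (2 * l * r ^ 2 * tangentialSq w r ω + 2 * r * tangentialSq w r ω
      + r ^ 2 * tangentialSqDeriv w r ω))

/-- The Carleman energy on the sphere of radius `r`. -/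
def energy (l κ : ℝ) (w : E3 → ℝ) (r : ℝ) : ℝ := ∫ ω, energyDensity l κ w r ω ∂σ

variable {w : E3 → ℝ}

lemma continuous_polar (hw : ContDiff ℝ 2 w) : Continuous fun p : ℝ × S2 => w (p.1 • (p.2 : E3)) :=
  hw.continuous.comp (by fun_prop)

lemma continuous_conj₀ (hw : ContDiff ℝ 2 w) (l : ℝ) : Continuous (Function.uncurry (conj₀ l w)) :=
    by
  have := continuous_polar hw
  unfold conj₀ Function.uncurry
  fun_prop

lemma continuous_conj₁ (hw : ContDiff ℝ 2 w) (l : ℝ) : Continuous (Function.uncurry (conj₁ l w)) :=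
    by
  have h0 := continuous_polar hw
  have h1 : Continuous fun p : ℝ × S2 => radial₁ w p.1 p.2 := continuous_radial₁ hw
  unfold conj₁ Function.uncurry
  fun_prop

lemma continuous_conj₂ (hw : ContDiff ℝ 2 w) (l : ℝ) : Continuous (Function.uncurry (conj₂ l w)) :=
    by
  have h0 := continuous_polar hw
  have h1 : Continuous fun p : ℝ × S2 => radial₁ w p.1 p.2 := continuous_radial₁ hw
  have h2 : Continuous fun p : ℝ × S2 => radial₂ w p.1 p.2 := continuous_radial₂ hw
  unfold conj₂ Function.uncurry
  fun_prop

lemma continuous_energyDensity (hw : ContDiff ℝ 2 w) (l κ : ℝ) : Continuous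
    (Function.uncurry (energyDensity l κ w)) := by
  have h0 : Continuous fun p : ℝ × S2 => conj₀ l w p.1 p.2 := continuous_conj₀ hw l
  have h1 : Continuous fun p : ℝ × S2 => conj₁ l w p.1 p.2 := continuous_conj₁ hw l
  have h2 : Continuous fun p : ℝ × S2 => tangentialSq w p.1 p.2 := continuous_tangentialSq hw
  unfold energyDensity Function.uncurry
  fun_prop

lemma continuous_energyDensityDeriv (hw : ContDiff ℝ 2 w) (l κ : ℝ) : Continuous
    (Function.uncurry (energyDensityDeriv l κ w)) := by
  have h0 : Continuous fun p : ℝ × S2 => conj₀ l w p.1 p.2 := continuous_conj₀ hw l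
  have h1 : Continuous fun p : ℝ × S2 => conj₁ l w p.1 p.2 := continuous_conj₁ hw l
  have h2 : Continuous fun p : ℝ × S2 => conj₂ l w p.1 p.2 := continuous_conj₂ hw l
  have h3 : Continuous fun p : ℝ × S2 => tangentialSq w p.1 p.2 := continuous_tangentialSq hw
  have h4 : Continuous fun p : ℝ × S2 => tangentialSqDeriv w p.1 p.2 :=
      continuous_tangentialSqDeriv hw
  unfold energyDensityDeriv Function.uncurry
  fun_prop

lemma hasDerivAt_conj₀ (hw : ContDiff ℝ 2 w) (l : ℝ) (r : ℝ) (ω : S2) :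
    HasDerivAt (fun s => conj₀ l w s ω) (conj₁ l w r ω) r := by
  have he : HasDerivAt (fun s => exp (l * s)) (exp (l * r) * l) r := by
    simpa using ((hasDerivAt_id r).const_mul l).exp
  refine (he.mul ((hasDerivAt_id r).mul (hasDerivAt_polar hw r ω))).congr_deriv ?_
  simp [conj₁]; ring

lemma hasDerivAt_conj₁ (hw : ContDiff ℝ 2 w) (l : ℝ) (r : ℝ) (ω : S2) :
    HasDerivAt (fun s => conj₁ l w s ω) (conj₂ l w r ω) r := by
  have he : HasDerivAt (fun s => exp (l * s)) (exp (l * r) * l) r := by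
    simpa using ((hasDerivAt_id r).const_mul l).exp
  refine (he.mul (((hasDerivAt_id r).mul (hasDerivAt_radial₁ hw r ω)).add
    ((((hasDerivAt_id r).const_mul l).const_add 1).mul (hasDerivAt_polar hw r ω)))).congr_deriv ?_
  simp [conj₂]; ring

lemma hasDerivAt_energyDensity (hw : ContDiff ℝ 2 w) (l κ : ℝ) (r : ℝ) (ω : S2) :
    HasDerivAt (fun s => energyDensity l κ w s ω) (energyDensityDeriv l κ w r ω) r := by
  have he : HasDerivAt (fun s => exp (l * s)) (exp (l * r) * l) r := by
    simpa using ((hasDerivAt_id r).const_mul l).exp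
  have h0 := hasDerivAt_conj₀ hw l r ω
  have h1 := hasDerivAt_conj₁ hw l r ω
  have h2 := hasDerivAt_tangentialSq hw r ω
  refine (((((h1.pow 2).add ((h0.pow 2).const_mul (l ^ 2))).const_mul (-2 * l)).add
    (((h0.mul h1).sub ((h0.pow 2).const_mul l)).const_mul (l * κ))).add
    ((((he.pow 2).mul ((hasDerivAt_id r).pow 2)).mul h2).const_mul (2 * l))).congr_deriv ?_
  simp [energyDensityDeriv]; ring

lemma hasDerivAt_energy (hw : ContDiff ℝ 2 w) (l κ : ℝ) (r : ℝ) :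
    HasDerivAt (energy l κ w) (∫ ω, energyDensityDeriv l κ w r ω ∂σ) r :=
  hasDerivAt_sphere_integral (continuous_energyDensity hw l κ)
      (continuous_energyDensityDeriv hw l κ)
    (hasDerivAt_energyDensity hw l κ) r

lemma tangentialSq_nonneg (r : ℝ) (ω : S2) : 0 ≤ tangentialSq w r ω := by
  have h1 := clm_apply_eq_sum (fderiv ℝ w (r • (ω : E3))) ω
  have h2 := Finset.sum_mul_sq_le_sq_mul_sq Finset.univ (fun j => (ω : E3) j)
    fun j => fderiv ℝ w (r • (ω : E3)) (EuclideanSpace.single j 1)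
  have h3 : ∑ j, (ω : E3) j ^ 2 = 1 := by
    have := EuclideanSpace.norm_sq_eq (ω : E3)
    simpa using this.symm
  rw [← h1, h3, one_mul] at h2
  exact sub_nonneg.2 h2

/-- Pointwise form of the Carleman estimate, modulo terms with vanishing spherical mean. -/
lemma energyDensityDeriv_le (l κ : ℝ) {μ ρ : ℝ} (hμ : 0 < μ) (hκ : κ = 2 / ρ) (hlκ : κ ≤ l)
    (hlμ : 1 / μ ≤ l)
    {r : ℝ} (hr : r ∈ Set.Icc μ ρ) (ω : S2) :
    energyDensityDeriv l κ w r ω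
      - (4 * l * exp (l * r) ^ 2 * (1 + l * r) - l * κ * exp (l * r) ^ 2 * r) *
        (r * (tangentialSq w r ω
          + w (r • (ω : E3)) * (lap w (r • (ω : E3)) - radial₂ w r ω))
          - 2 * w (r • (ω : E3)) * radial₁ w r ω)
      - 4 * l * exp (l * r) ^ 2 * r * (tangentialSq w r ω + r * tangentialSqDeriv w r ω / 2
        + r * radial₁ w r ω * (lap w (r • (ω : E3)) - radial₂ w r ω)
        - 2 * radial₁ w r ω ^ 2)
    ≤ exp (l * r) ^ 2 * r ^ 2 * (2 * lap w (r • (ω : E3)) ^ 2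
      - l * κ / 12 * (∑ j, fderiv ℝ w (r • (ω : E3)) (EuclideanSpace.single j 1) ^ 2)
      - l ^ 3 * κ / 12 * w (r • (ω : E3)) ^ 2) := by
  have hr0 : 0 < r := hμ.trans_le hr.1
  have hρ : 0 < ρ := hr0.trans_le hr.2
  have hκ0 : 0 < κ := by rw [hκ]; positivity
  have hl0 : 0 < l := hκ0.trans_le hlκ
  have hT := tangentialSq_nonneg (w := w) r ω
  have hgrad : ∑ j, fderiv ℝ w (r • (ω : E3)) (EuclideanSpace.single j 1) ^ 2
      = tangentialSq w r ω + radial₁ w r ω ^ 2 := by simp [tangentialSq]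
  rw [hgrad]
  have hκr : κ * r ≤ 2 := by
    rw [hκ, div_mul_eq_mul_div, div_le_iff₀ hρ]; linarith [hr.2]
  have hlr : 1 ≤ l * r := by
    rw [div_le_iff₀ hμ] at hlμ
    exact hlμ.trans (by gcongr; exact hr.1)
  simp only [energyDensityDeriv, conj₀, conj₁, conj₂]
  generalize exp (l * r) = E
  generalize tangentialSq w r ω = T at *
  generalize tangentialSqDeriv w r ω = T'
  generalize radial₁ w r ω = p
  generalize radial₂ w r ω = q
  generalize lap w (r • (ω : E3)) = D
  generalize w (r • (ω : E3)) = u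
  set v := E * (r * u) with hv
  set v' := E * (r * p + (1 + l * r) * u) with hv'
  set g := E * (r * D) with hg
  have key := carleman_quadratic_le hl0 hκ0 hr0 hT hκr hlκ hlr hv hv' (g := g)
  refine le_of_eq_of_le ?_ (key.trans (le_of_eq ?_))
  · rw [hv, hv', hg]; ring
  · rw [hv, hg]; ring

lemma integral_sphere_le_of_corrections {f g₁ g₂ h : S2 → ℝ} {α β c : ℝ} (hf : Continuous f)
    (hg₁ : Continuous g₁) (hg₂ : Continuous g₂) (hh : Continuous h) (h₁ : ∫ ω, g₁ ω ∂σ = 0)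
    (h₂ : ∫ ω, g₂ ω ∂σ = 0) (hle : ∀ ω, f ω - α * g₁ ω - β * g₂ ω ≤ c * h ω) :
    ∫ ω, f ω ∂σ ≤ c * ∫ ω, h ω ∂σ := by
  have i₀ := integrable_sphere hf
  have i₁ := (integrable_sphere hg₁).const_mul α
  have i₂ := (integrable_sphere hg₂).const_mul β
  have i₁₂ : Integrable (fun ω => f ω - α * g₁ ω) σ := i₀.sub i₁
  have := integral_mono (i₁₂.sub i₂) ((integrable_sphere hh).const_mul c) hle
  simp only [Pi.sub_apply] at this
  rw [integral_sub i₁₂ i₂, integral_sub i₀ i₁] at this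
  simpa [integral_const_mul, h₁, h₂] using this

lemma energy_deriv_le (hw : ContDiff ℝ 2 w) (l κ : ℝ) {μ ρ : ℝ} (hμ : 0 < μ) (hκ : κ = 2 / ρ)
    (hlκ : κ ≤ l) (hlμ : 1 / μ ≤ l)
    {r : ℝ} (hr : r ∈ Set.Icc μ ρ) :
    ∫ ω, energyDensityDeriv l κ w r ω ∂σ ≤ exp (l * r) ^ 2 * r ^ 2 *
      ∫ ω : S2, (2 * lap w (r • (ω : E3)) ^ 2
        - l * κ / 12 * (∑ j, fderiv ℝ w (r • (ω : E3)) (EuclideanSpace.single j 1) ^ 2)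
        - l ^ 3 * κ / 12 * w (r • (ω : E3)) ^ 2) ∂σ := by
  have hr0 : r ≠ 0 := (hμ.trans_le hr.1).ne'
  have hm : Continuous fun ω : S2 => r • (ω : E3) := by fun_prop
  have hpt : Continuous fun ω : S2 => (r, ω) := by fun_prop
  have c0 : Continuous fun ω : S2 => w (r • (ω : E3)) := hw.continuous.comp hm
  have c1 : Continuous fun ω : S2 => radial₁ w r ω := (continuous_radial₁ hw).uncurry_left r
  have c2 : Continuous fun ω : S2 => radial₂ w r ω := (continuous_radial₂ hw).uncurry_left r
  have c3 : Continuous fun ω : S2 => tangentialSq w r ω :=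
      (continuous_tangentialSq hw).uncurry_left r
  have c4 : Continuous fun ω : S2 => tangentialSqDeriv w r ω :=
      (continuous_tangentialSqDeriv hw).uncurry_left r
  have c5 : Continuous fun ω : S2 => lap w (r • (ω : E3)) := (continuous_lap hw).comp hm
  have c6 : Continuous fun ω : S2 => energyDensityDeriv l κ w r ω :=
    (continuous_energyDensityDeriv hw l κ).uncurry_left r
  have c7 : ∀ v, Continuous fun ω : S2 => fderiv ℝ w (r • (ω : E3)) v :=
    fun v => (continuous_fderiv_polar hw v).comp hpt
  exact integral_sphere_le_of_corrections c6 (by fun_prop) (by fun_prop)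
    (((continuous_const.mul (c5.pow 2)).sub
      (continuous_const.mul (continuous_finsetSum _ fun j _ => (c7 _).pow 2))).sub
      (continuous_const.mul (c0.pow 2)))
    (integral_sphere_green_self hw hr0) (integral_sphere_green_radial hw hr0)
    (energyDensityDeriv_le l κ hμ hκ hlκ hlμ hr)

end Carleman

/-- The density of the squared `H¹` norm of the system `w`. -/
def sobolevDensity {N : ℕ} (w : Fin N → E3 → ℝ) (x : E3) : ℝ :=
  ∑ k, (w k x ^ 2 + ∑ j, fderiv ℝ (w k) x (EuclideanSpace.single j 1) ^ 2)

lemma sobolevDensity_nonneg {N : ℕ} (w : Fin N → E3 → ℝ) (x : E3) : 0 ≤ sobolevDensity w x :=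
  Finset.sum_nonneg fun _ _ => by positivity

lemma continuous_sobolevDensity {N : ℕ} {w : Fin N → E3 → ℝ} (hw : ∀ k, ContDiff ℝ 2 (w k)) :
    Continuous (sobolevDensity w) :=
  continuous_finsetSum _ fun k _ => ((hw k).continuous.pow 2).add
    (continuous_finsetSum _ fun _ _ => (contDiff_fderiv_apply (hw k) _).continuous.pow 2)

lemma energyDensity_le {l κ : ℝ} (hκ : 0 ≤ κ) (hκl : κ ≤ l) (w : E3 → ℝ) (r : ℝ) (ω : S2) :
    energyDensity l κ w r ω ≤ 2 * l * (exp (l * r) ^ 2 * r ^ 2 * tangentialSq w r ω) := by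
  have hl : 0 ≤ l := hκ.trans hκl
  unfold energyDensity
  generalize conj₀ l w r ω = v
  generalize conj₁ l w r ω = v'
  have h1 : l * κ * (v * v') ≤ l * (v' ^ 2 + l ^ 2 * v ^ 2) := by
    have : κ * (v * v') ≤ v' ^ 2 + κ ^ 2 * v ^ 2 := by
      linarith [sq_nonneg (v' - κ * v / 2), mul_nonneg (sq_nonneg κ) (sq_nonneg v)]
    have h2 : κ ^ 2 * v ^ 2 ≤ l ^ 2 * v ^ 2 := by gcongr
    rw [mul_assoc]
    exact mul_le_mul_of_nonneg_left (by linarith) hl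
  have h2 : 0 ≤ l * κ * (l * v ^ 2) := by positivity
  have h3 : 0 ≤ l * (v' ^ 2 + l ^ 2 * v ^ 2) := by positivity
  linarith

lemma neg_energyDensity_le {l κ : ℝ} (hκ : 0 ≤ κ) (hκl : κ ≤ l) (hl : 1 ≤ l) (w : E3 → ℝ) {r : ℝ}
    (hlr : 1 ≤ l * r) (ω : S2) :
    -energyDensity l κ w r ω ≤ 36 * l ^ 3 * (exp (l * r) ^ 2 * r ^ 2) *
      (w (r • (ω : E3)) ^ 2 + radial₁ w r ω ^ 2) := by
  have hl0 : 0 < l := one_pos.trans_le hl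
  have hT : 0 ≤ 2 * l * (exp (l * r) ^ 2 * r ^ 2 * tangentialSq w r ω) := by
    have := tangentialSq_nonneg (w := w) r ω
    positivity
  have h1 : -energyDensity l κ w r ω ≤
      4 * l * (conj₁ l w r ω ^ 2 + l ^ 2 * conj₀ l w r ω ^ 2) := by
    unfold energyDensity
    generalize conj₀ l w r ω = v
    generalize conj₁ l w r ω = v'
    have h1 : -(l * κ * (v * v')) ≤ l * (v' ^ 2 + l ^ 2 * v ^ 2) := by
      have : -(κ * (v * v')) ≤ v' ^ 2 + κ ^ 2 * v ^ 2 := by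
        linarith [sq_nonneg (v' + κ * v / 2), mul_nonneg (sq_nonneg κ) (sq_nonneg v)]
      have h2 : κ ^ 2 * v ^ 2 ≤ l ^ 2 * v ^ 2 := by gcongr
      rw [mul_assoc, ← mul_neg]
      exact mul_le_mul_of_nonneg_left (by linarith) hl0.le
    have h2 : l * κ * (l * v ^ 2) ≤ l * l * (l * v ^ 2) := by gcongr
    have h3 : 0 ≤ l * (v' ^ 2 + l ^ 2 * v ^ 2) := by positivity
    have h4 : 0 ≤ l * v' ^ 2 := by positivity
    linarith
  refine h1.trans ?_
  unfold conj₀ conj₁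
  generalize exp (l * r) = E
  generalize radial₁ w r ω = p
  generalize w (r • (ω : E3)) = u
  have h2 : (r * p + (1 + l * r) * u) ^ 2 ≤ 2 * (r ^ 2 * p ^ 2) + 8 * (l ^ 2 * r ^ 2 * u ^ 2) := by
    have h3 : (1 + l * r) ^ 2 * u ^ 2 ≤ (2 * (l * r)) ^ 2 * u ^ 2 := by
      gcongr; linarith
    linarith [sq_nonneg (r * p - (1 + l * r) * u)]
  have h4 : r ^ 2 * p ^ 2 ≤ l ^ 2 * (r ^ 2 * p ^ 2) :=
    le_mul_of_one_le_left (by positivity) (one_le_pow₀ hl)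
  have h5 : (r * p + (1 + l * r) * u) ^ 2 + l ^ 2 * (r * u) ^ 2
      ≤ 9 * l ^ 2 * r ^ 2 * (u ^ 2 + p ^ 2) := by
    have : 0 ≤ l ^ 2 * (r ^ 2 * p ^ 2) := by positivity
    linarith
  calc 4 * l * ((E * (r * p + (1 + l * r) * u)) ^ 2 + l ^ 2 * (E * (r * u)) ^ 2)
      = 4 * l * E ^ 2 * ((r * p + (1 + l * r) * u) ^ 2 + l ^ 2 * (r * u) ^ 2) := by ring
    _ ≤ 4 * l * E ^ 2 * (9 * l ^ 2 * r ^ 2 * (u ^ 2 + p ^ 2)) := by gcongr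
    _ = _ := by ring

lemma energy_le {w : E3 → ℝ} (hw : ContDiff ℝ 2 w) {l κ : ℝ} (hκ : 0 ≤ κ) (hκl : κ ≤ l) (r : ℝ) :
    energy l κ w r ≤ 2 * l * (exp (l * r) ^ 2 * r ^ 2) * ∫ ω, tangentialSq w r ω ∂σ := by
  rw [energy, ← integral_const_mul]
  exact integral_mono (integrable_sphere ((continuous_energyDensity hw l κ).uncurry_left r))
    ((integrable_sphere ((continuous_tangentialSq hw).uncurry_left r)).const_mul _)
    fun ω => (energyDensity_le hκ hκl w r ω).trans_eq (by ring)

lemma continuous_cauchyData {w : E3 → ℝ} (hw : ContDiff ℝ 2 w) (r : ℝ) :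
    Continuous fun ω : S2 => w (r • (ω : E3)) ^ 2 + radial₁ w r ω ^ 2 :=
  ((hw.continuous.comp (by fun_prop : Continuous fun ω : S2 => r • (ω : E3))).pow 2).add
    (((continuous_radial₁ hw).uncurry_left r).pow 2)

lemma neg_energy_le {w : E3 → ℝ} (hw : ContDiff ℝ 2 w) {l κ : ℝ} (hκ : 0 ≤ κ) (hκl : κ ≤ l)
    (hl : 1 ≤ l) {r : ℝ} (hlr : 1 ≤ l * r) :
    -energy l κ w r ≤ 36 * l ^ 3 * (exp (l * r) ^ 2 * r ^ 2) *
      ∫ ω : S2, (w (r • (ω : E3)) ^ 2 + radial₁ w r ω ^ 2) ∂σ := by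
  rw [energy, ← integral_const_mul, ← integral_neg]
  exact integral_mono
    (integrable_sphere ((continuous_energyDensity hw l κ).uncurry_left r)).neg
    ((integrable_sphere (continuous_cauchyData hw r)).const_mul _)
    fun ω => neg_energyDensity_le hκ hκl hl w hlr ω

/-- Differential inequality for the total energy of a system satisfying `|Δw|² ≤ K |∇w|²`. -/
lemma sum_energy_deriv_le {N : ℕ} {w : Fin N → E3 → ℝ} (hw : ∀ k, ContDiff ℝ 2 (w k))
    {μ ρ K l : ℝ} (hμ : 0 < μ) (hK : 0 ≤ K) (hl : 1 ≤ l) (hlρ : 2 / ρ ≤ l)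
    (hlμ : 1 / μ ≤ l) (hlK : 6 * ρ * (2 * K + 1) ≤ l)
    (hlap : ∀ x, ‖x‖ < ρ → ∑ k, lap (w k) x ^ 2 ≤
      K * ∑ k, ∑ j, fderiv ℝ (w k) x (EuclideanSpace.single j 1) ^ 2)
    {r : ℝ} (hr : r ∈ Set.Ioo μ ρ) :
    ∑ k, ∫ ω, energyDensityDeriv l (2 / ρ) (w k) r ω ∂σ
      ≤ -(exp (l * r) ^ 2 * (r ^ 2 * ∫ ω : S2, sobolevDensity w (r • (ω : E3)) ∂σ)) := by
  have hr0 : 0 < r := hμ.trans hr.1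
  have hρ : 0 < ρ := hr0.trans hr.2
  have hl6 : 2 * K + 1 ≤ l * (2 / ρ) / 12 := by
    rw [show l * (2 / ρ) / 12 = l / (6 * ρ) by field_simp; norm_num, le_div_iff₀ (by positivity)]
    linarith
  have hl3 : 1 ≤ l ^ 3 * (2 / ρ) / 12 := by
    calc (1 : ℝ) ≤ l * (2 / ρ) / 12 := by linarith
      _ ≤ l ^ 2 * (l * (2 / ρ) / 12) :=
        le_mul_of_one_le_left (by positivity) (one_le_pow₀ hl)
      _ = _ := by ring
  have hm : Continuous fun ω : S2 => r • (ω : E3) := by fun_prop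
  have hc : ∀ k, Continuous fun ω : S2 => 2 * lap (w k) (r • (ω : E3)) ^ 2
      - l * (2 / ρ) / 12 * (∑ j, fderiv ℝ (w k) (r • (ω : E3)) (EuclideanSpace.single j 1) ^ 2)
      - l ^ 3 * (2 / ρ) / 12 * w k (r • (ω : E3)) ^ 2 := fun k =>
    ((continuous_const.mul (((continuous_lap (hw k)).comp hm).pow 2)).sub
      (continuous_const.mul (continuous_finsetSum _ fun j _ =>
        ((contDiff_fderiv_apply (hw k) _).continuous.comp hm).pow 2))).sub
      (continuous_const.mul (((hw k).continuous.comp hm).pow 2))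
  refine (Finset.sum_le_sum fun k _ =>
    energy_deriv_le (hw k) l (2 / ρ) hμ rfl hlρ hlμ (Set.Ioo_subset_Icc_self hr)).trans ?_
  rw [← Finset.mul_sum, ← integral_finsetSum _ fun k _ => integrable_sphere (hc k), ← mul_assoc,
    ← mul_neg, ← integral_neg]
  refine mul_le_mul_of_nonneg_left ?_ (by positivity)
  refine integral_mono (integrable_finsetSum _ fun k _ => integrable_sphere (hc k))
    (integrable_sphere ((continuous_sobolevDensity hw).comp hm)).neg fun ω => ?_
  have h1 := hlap (r • (ω : E3)) (by simpa [norm_smul, abs_of_pos hr0] using hr.2)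
  simp only [sobolevDensity, Finset.sum_sub_distrib, Finset.sum_add_distrib, ← Finset.mul_sum]
  generalize ∑ k, lap (w k) (r • (ω : E3)) ^ 2 = a at h1
  have h2 : 0 ≤ ∑ k, ∑ j, fderiv ℝ (w k) (r • (ω : E3)) (EuclideanSpace.single j 1) ^ 2 := by
    positivity
  have h3 : 0 ≤ ∑ k, w k (r • (ω : E3)) ^ 2 := by positivity
  generalize ∑ k, ∑ j, fderiv ℝ (w k) (r • (ω : E3)) (EuclideanSpace.single j 1) ^ 2 = b at *
  generalize ∑ k, w k (r • (ω : E3)) ^ 2 = c at *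
  linarith [mul_le_mul_of_nonneg_right hl6 h2, mul_le_mul_of_nonneg_right hl3 h3]

/-- The Carleman estimate for the Cauchy problem, integrated over an annulus. -/
lemma integral_annulus_sobolevDensity_le {N : ℕ} {w : Fin N → E3 → ℝ}
    (hw : ∀ k, ContDiff ℝ 2 (w k)) {μ ρ η K l : ℝ} (hμ : 0 < μ) (hη : 0 < η) (hηρ : μ + η < ρ)
    (hK : 0 ≤ K) (hl : 1 ≤ l) (hlρ : 2 / ρ ≤ l) (hlμ : 1 / μ ≤ l) (hlK : 6 * ρ * (2 * K + 1) ≤ l)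
    (hlap : ∀ x, ‖x‖ < ρ → ∑ k, lap (w k) x ^ 2 ≤
      K * ∑ k, ∑ j, fderiv ℝ (w k) x (EuclideanSpace.single j 1) ^ 2) :
    ∫ x in annulus (μ + η) ρ, sobolevDensity w x ≤
      l ^ 3 * (2 * ρ ^ 2 * exp (-(2 * l * η)) * ∑ k, ∫ ω, tangentialSq (w k) μ ω ∂σ
        + 36 * ρ ^ 2 * exp (2 * l * ρ) *
          ∑ k, ∫ ω : S2, (w k (ρ • (ω : E3)) ^ 2 + radial₁ (w k) ρ ω ^ 2) ∂σ) := by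
  have hμρ : μ < ρ := by linarith
  have hρ : 0 < ρ := hμ.trans hμρ
  have hl0 : 0 < l := one_pos.trans_le hl
  have hκ : 0 ≤ 2 / ρ := by positivity
  have hlr : 1 ≤ l * ρ := by
    rw [div_le_iff₀ hμ] at hlμ
    exact hlμ.trans (by gcongr)
  set G : ℝ → ℝ := fun r => ∫ ω : S2, sobolevDensity w (r • (ω : E3)) ∂σ with hG
  have hGc : Continuous G :=
    continuous_sphere_integral ((continuous_sobolevDensity hw).comp (by fun_prop))
  have hG0 : ∀ r, 0 ≤ G r := fun r => integral_nonneg fun ω => sobolevDensity_nonneg w _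
  have hφc : Continuous fun r => exp (l * r) ^ 2 * (r ^ 2 * G r) := by fun_prop
  have hderiv : ∀ r, HasDerivAt (fun r => ∑ k, energy l (2 / ρ) (w k) r)
      (∑ k, ∫ ω, energyDensityDeriv l (2 / ρ) (w k) r ω ∂σ) r := fun r =>
    HasDerivAt.fun_sum fun k _ => hasDerivAt_energy (hw k) l (2 / ρ) r
  have key := intervalIntegral.sub_le_integral_of_hasDeriv_right_of_le hμρ.le
    (fun r _ => (hderiv r).continuousAt.continuousWithinAt)
    (fun r _ => (hderiv r).hasDerivWithinAt) (hφc.neg.integrableOn_Icc)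
    (fun r hr => sum_energy_deriv_le hw hμ hK hl hlρ hlμ hlK hlap hr)
  simp only [Pi.neg_apply] at key
  rw [intervalIntegral.integral_neg, intervalIntegral.integral_of_le hμρ.le,
    integral_Ioc_eq_integral_Ioo] at key
  have hint : ∀ a b : ℝ, IntegrableOn (fun r => exp (l * r) ^ 2 * (r ^ 2 * G r)) (Set.Ioo a b) :=
    fun a b => (hφc.integrableOn_Icc).mono_set Set.Ioo_subset_Icc_self
  have hint' : ∀ a b : ℝ, IntegrableOn (fun r => r ^ 2 * G r) (Set.Ioo a b) :=
    fun a b => ((by fun_prop : Continuous fun r => r ^ 2 * G r).integrableOn_Icc).mono_set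
      Set.Ioo_subset_Icc_self
  have h1 : exp (l * (μ + η)) ^ 2 * ∫ x in annulus (μ + η) ρ, sobolevDensity w x
      ≤ ∫ r in Set.Ioo μ ρ, exp (l * r) ^ 2 * (r ^ 2 * G r) := by
    rw [setIntegral_annulus_eq_polar (by positivity) (continuous_sobolevDensity hw),
      ← integral_const_mul]
    calc _ ≤ ∫ r in Set.Ioo (μ + η) ρ, exp (l * r) ^ 2 * (r ^ 2 * G r) := by
          refine setIntegral_mono_on ((hint' _ _).const_mul _) (hint _ _) measurableSet_Ioo
            fun r hr => ?_
          have := hG0 r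
          have := hr.1.le
          gcongr
      _ ≤ _ := by
          refine setIntegral_mono_set (hint _ _) (ae_of_all _ fun r => ?_)
            (Set.Ioo_subset_Ioo_left (by linarith)).eventuallyLE
          have := hG0 r
          positivity
  have h2 : ∑ k, energy l (2 / ρ) (w k) μ ≤ 2 * l * (exp (l * μ) ^ 2 * μ ^ 2) *
      ∑ k, ∫ ω, tangentialSq (w k) μ ω ∂σ := by
    rw [Finset.mul_sum]
    exact Finset.sum_le_sum fun k _ => energy_le (hw k) hκ hlρ μ
  have h3 : -∑ k, energy l (2 / ρ) (w k) ρ ≤ 36 * l ^ 3 * (exp (l * ρ) ^ 2 * ρ ^ 2) *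
      ∑ k, ∫ ω : S2, (w k (ρ • (ω : E3)) ^ 2 + radial₁ (w k) ρ ω ^ 2) ∂σ := by
    rw [Finset.mul_sum, ← Finset.sum_neg_distrib]
    exact Finset.sum_le_sum fun k _ => neg_energy_le (hw k) hκ hlρ hl hlr
  have hT : 0 ≤ ∑ k, ∫ ω, tangentialSq (w k) μ ω ∂σ :=
    Finset.sum_nonneg fun k _ => integral_nonneg fun ω => tangentialSq_nonneg _ _
  have hB : 0 ≤ ∑ k, ∫ ω : S2, (w k (ρ • (ω : E3)) ^ 2 + radial₁ (w k) ρ ω ^ 2) ∂σ :=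
    Finset.sum_nonneg fun k _ => integral_nonneg fun ω => by positivity
  generalize ∑ k, ∫ ω, tangentialSq (w k) μ ω ∂σ = T at *
  generalize ∑ k, ∫ ω : S2, (w k (ρ • (ω : E3)) ^ 2 + radial₁ (w k) ρ ω ^ 2) ∂σ = B at *
  have hexp : ∀ t, exp t ^ 2 = exp (2 * t) := fun t => by rw [← exp_nat_mul]; norm_num
  have h4 : exp (2 * (l * (μ + η))) * ∫ x in annulus (μ + η) ρ, sobolevDensity w x ≤
      2 * l * (exp (2 * (l * μ)) * μ ^ 2) * T + 36 * l ^ 3 * (exp (2 * (l * ρ)) * ρ ^ 2) * B := by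
    simp only [hexp] at h1 h2 h3 key
    linarith
  have hll : l ≤ l ^ 3 := le_self_pow₀ hl (by norm_num)
  rw [← le_div_iff₀' (exp_pos _)] at h4
  refine h4.trans ?_
  rw [add_div, mul_add (l ^ 3)]
  refine add_le_add ?_ ?_
  · rw [div_le_iff₀ (exp_pos _)]
    calc 2 * l * (exp (2 * (l * μ)) * μ ^ 2) * T
        ≤ 2 * l ^ 3 * (exp (2 * (l * μ)) * ρ ^ 2) * T := by gcongr
      _ = l ^ 3 * (2 * ρ ^ 2 * (exp (-(2 * l * η)) * exp (2 * (l * (μ + η)))) * T) := by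
          rw [← exp_add]; ring_nf
      _ = _ := by ring
  · refine (div_le_self (by positivity) (one_le_exp (by positivity))).trans_eq ?_
    ring_nf

lemma norm_gradient_sq (f : E3 → ℝ) (x : E3) :
    ‖gradient f x‖ ^ 2 = ∑ j, fderiv ℝ f x (EuclideanSpace.single j 1) ^ 2 := by
  rw [EuclideanSpace.norm_sq_eq]
  refine Finset.sum_congr rfl fun j _ => ?_
  have h : fderiv ℝ f x (EuclideanSpace.single j 1) = inner ℝ (gradient f x)
      (EuclideanSpace.single j 1) :=
    InnerProductSpace.toDual_symm_apply.symm
  rw [h, EuclideanSpace.inner_single_right]; simp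

lemma gradient_fun_sub {f g : E3 → ℝ} {x : E3} (hf : DifferentiableAt ℝ f x)
    (hg : DifferentiableAt ℝ g x) :
    gradient (fun y => f y - g y) x = gradient f x - gradient g x := by
  rw [gradient, fderiv_fun_sub hf hg, map_sub]; rfl

lemma lap_fun_sub {f g : E3 → ℝ} (hf : ContDiff ℝ 2 f) (hg : ContDiff ℝ 2 g) (x : E3) :
    lap (fun y => f y - g y) x = lap f x - lap g x := by
  have h : fderiv ℝ (fun y => f y - g y) = fun y => fderiv ℝ f y - fderiv ℝ g y := funext fun y =>
    fderiv_fun_sub (hf.differentiable two_ne_zero y) (hg.differentiable two_ne_zero y)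
  rw [lap_eq_sum_fderiv_fderiv (hf.sub hg), lap_eq_sum_fderiv_fderiv hf,
    lap_eq_sum_fderiv_fderiv hg, ← Finset.sum_sub_distrib, h]
  rw [fderiv_fun_sub (differentiable_fderiv_of_contDiff_two hf x)
    (differentiable_fderiv_of_contDiff_two hg x)]
  rfl

/-- A quadratic map is Lipschitz on bounded sets. -/
lemma IsQuadratic.exists_norm_sub_le {N : ℕ}
    {F : (Fin N → EuclideanSpace ℝ (Fin 3)) → (Fin N → ℝ)} (hF : IsQuadratic N F) {A : ℝ}
        (hA : 0 ≤ A) :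
    ∃ K : ℝ, 0 ≤ K ∧ ∀ y y', ‖y‖ ≤ A → ‖y'‖ ≤ A → ‖F y - F y'‖ ≤ K * ‖y - y'‖ := by
  obtain ⟨B, L, c, hF⟩ := hF
  let B' := LinearMap.toContinuousLinearMap (LinearMap.toContinuousLinearMap.toLinearMap ∘ₗ B)
  let L' := LinearMap.toContinuousLinearMap L
  refine ⟨2 * A * ‖B'‖ + ‖L'‖, by positivity, fun y y' hy hy' => ?_⟩
  have h : F y - F y' = B' (y - y') y + B' y' (y - y') + L' (y - y') := by
    simp [B', L', hF]; abel
  rw [h]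
  calc ‖B' (y - y') y + B' y' (y - y') + L' (y - y')‖
      ≤ ‖B' (y - y') y‖ + ‖B' y' (y - y')‖ + ‖L' (y - y')‖ := norm_add₃_le
    _ ≤ ‖B'‖ * ‖y - y'‖ * A + ‖B'‖ * A * ‖y - y'‖ + ‖L'‖ * ‖y - y'‖ := by
        gcongr
        · exact (B'.le_opNorm₂ _ _).trans (by gcongr)
        · exact (B'.le_opNorm₂ _ _).trans (by gcongr)
        · exact L'.le_opNorm _
    _ = _ := by ring

lemma IsQuadratic.exists_sum_sq_sub_le {N : ℕ}
    {F : (Fin N → EuclideanSpace ℝ (Fin 3)) → (Fin N → ℝ)} (hF : IsQuadratic N F) {A : ℝ}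
        (hA : 0 ≤ A) :
    ∃ K : ℝ, 0 ≤ K ∧ ∀ y y', (∀ k, ‖y k‖ ≤ A) → (∀ k, ‖y' k‖ ≤ A) →
      ∑ k, (F y k - F y' k) ^ 2 ≤ K * ∑ k, ‖y k - y' k‖ ^ 2 := by
  obtain ⟨K, hK, h⟩ := hF.exists_norm_sub_le hA
  refine ⟨N * K ^ 2, by positivity, fun y y' hy hy' => ?_⟩
  have h1 := h y y' ((pi_norm_le_iff_of_nonneg hA).2 hy) ((pi_norm_le_iff_of_nonneg hA).2 hy')
  have h2 : ‖y - y'‖ ^ 2 ≤ ∑ k, ‖y k - y' k‖ ^ 2 := by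
    have hs : 0 ≤ ∑ k, ‖y k - y' k‖ ^ 2 := by positivity
    rw [← Real.le_sqrt (norm_nonneg _) hs, pi_norm_le_iff_of_nonneg (Real.sqrt_nonneg _)]
    exact fun k => Real.le_sqrt_of_sq_le
      (Finset.single_le_sum (f := fun k => ‖y k - y' k‖ ^ 2) (fun _ _ => by positivity)
        (Finset.mem_univ k))
  calc ∑ k, (F y k - F y' k) ^ 2 ≤ ∑ _k : Fin N, (K * ‖y - y'‖) ^ 2 := by
        refine Finset.sum_le_sum fun k _ => sq_le_sq' ?_ ?_
        · exact (abs_le.1 ((norm_le_pi_norm (F y - F y') k).trans h1)).1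
        · exact (abs_le.1 ((norm_le_pi_norm (F y - F y') k).trans h1)).2
    _ = N * K ^ 2 * ‖y - y'‖ ^ 2 := by simp; ring
    _ ≤ _ := by gcongr

lemma pow_three_mul_exp_neg_le {η l : ℝ} (hη : 0 < η) (hl : 0 ≤ l) :
    l ^ 3 * exp (-(2 * l * η)) ≤ 6 / η ^ 3 * exp (-(l * η)) := by
  have h : (l * η) ^ 3 / 6 ≤ exp (l * η) := by
    simpa [Nat.factorial] using pow_div_factorial_le_exp (l * η) (by positivity) 3
  have h1 : exp (-(2 * l * η)) = exp (-(l * η)) * (exp (l * η))⁻¹ := by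
    rw [← exp_neg, ← exp_add]; ring_nf
  rw [h1]
  calc l ^ 3 * (exp (-(l * η)) * (exp (l * η))⁻¹)
      = 6 / η ^ 3 * exp (-(l * η)) * ((l * η) ^ 3 / 6 * (exp (l * η))⁻¹) := by field_simp
    _ ≤ 6 / η ^ 3 * exp (-(l * η)) * 1 := by
        gcongr
        rw [← div_eq_mul_inv, div_le_one (exp_pos _)]
        exact h
    _ = _ := mul_one _

lemma sum_integral_tangentialSq_le {N : ℕ} {w : Fin N → E3 → ℝ} (hw : ∀ k, ContDiff ℝ 2 (w k))
    {μ A : ℝ} (hμ : 0 ≤ μ) (hA : ∀ k x, ‖x‖ ≤ μ → ‖gradient (w k) x‖ ≤ A) :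
    ∑ k, ∫ ω, tangentialSq (w k) μ ω ∂σ ≤ N * (A ^ 2 * (σ).real Set.univ) := by
  have h : ∀ k, ∫ ω, tangentialSq (w k) μ ω ∂σ ≤ A ^ 2 * (σ).real Set.univ := by
    intro k
    calc ∫ ω, tangentialSq (w k) μ ω ∂σ ≤ ∫ _, A ^ 2 ∂σ := by
          refine integral_mono
            (integrable_sphere ((continuous_tangentialSq (hw k)).uncurry_left μ))
            (integrable_const _) fun ω => ?_
          have h1 := hA k (μ • (ω : E3)) (by simp [norm_smul, abs_of_nonneg hμ])
          have h2 : ‖gradient (w k) (μ • (ω : E3))‖ ^ 2 ≤ A ^ 2 := by gcongr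
          rw [norm_gradient_sq] at h2
          exact (sub_le_self _ (sq_nonneg _)).trans h2
      _ = _ := by simp [mul_comm]
  calc _ ≤ ∑ _k : Fin N, A ^ 2 * (σ).real Set.univ := Finset.sum_le_sum fun k _ => h k
    _ = _ := by simp

/-- The Cauchy data in polar coordinates are controlled by their Hausdorff `L²` norms. -/
lemma exists_sum_integral_cauchyData_le {ρ : ℝ} (hρ : 0 < ρ) :
    ∃ C : ℝ, 0 < C ∧ ∀ (N : ℕ) (V₁ V₂ : E3 → Fin N → ℝ) (δ : ℝ),
      (∀ k, ContDiff ℝ 2 fun y => V₁ y k) → (∀ k, ContDiff ℝ 2 fun y => V₂ y k) →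
      (∫ x in Metric.sphere (0 : E3) ρ, ∑ k, (V₁ x k - V₂ x k) ^ 2 ∂(μH[2])) ≤ δ ^ 2 →
      (∫ x in Metric.sphere (0 : E3) ρ,
          ∑ k, (radialDeriv (fun y => V₁ y k) x - radialDeriv (fun y => V₂ y k) x) ^ 2
          ∂(μH[2])) ≤ δ ^ 2 →
      ∑ k, ∫ ω : S2, ((V₁ (ρ • (ω : E3)) k - V₂ (ρ • (ω : E3)) k) ^ 2
        + radial₁ (fun y => V₁ y k - V₂ y k) ρ ω ^ 2) ∂σ ≤ 2 * C * δ ^ 2 := by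
  obtain ⟨C, hC, h⟩ := integral_sphere_le_hausdorff hρ
  refine ⟨C, hC, fun N V₁ V₂ δ hV₁ hV₂ h₀ h₁ => ?_⟩
  have hw : ∀ k, ContDiff ℝ 2 fun y => V₁ y k - V₂ y k := fun k => (hV₁ k).sub (hV₂ k)
  have c₀ : Continuous fun x => ∑ k, (V₁ x k - V₂ x k) ^ 2 :=
    continuous_finsetSum _ fun k _ => (hw k).continuous.pow 2
  have c₁ : Continuous fun x => ∑ k, fderiv ℝ (fun y => V₁ y k - V₂ y k) x (ρ⁻¹ • x) ^ 2 :=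
    continuous_finsetSum _ fun k _ =>
      (((hw k).continuous_fderiv two_ne_zero).clm_apply (continuous_const_smul ρ⁻¹)).pow 2
  have b₀ := h _ c₀ fun x => by positivity
  have b₁ := h _ c₁ fun x => by positivity
  have e₁ : ∫ x in Metric.sphere (0 : E3) ρ,
        ∑ k, fderiv ℝ (fun y => V₁ y k - V₂ y k) x (ρ⁻¹ • x) ^ 2 ∂(μH[2])
      = ∫ x in Metric.sphere (0 : E3) ρ,
        ∑ k, (radialDeriv (fun y => V₁ y k) x - radialDeriv (fun y => V₂ y k) x) ^ 2 ∂(μH[2]) := by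
    refine setIntegral_congr_fun Metric.isClosed_sphere.measurableSet fun x hx => ?_
    have hx' : ‖x‖ = ρ := by simpa using hx
    refine Finset.sum_congr rfl fun k _ => ?_
    rw [fderiv_fun_sub ((hV₁ k).differentiable two_ne_zero x)
      ((hV₂ k).differentiable two_ne_zero x), radialDeriv, radialDeriv, hx', sub_apply]
  rw [e₁] at b₁
  have hsum : ∑ k, ∫ ω : S2, ((V₁ (ρ • (ω : E3)) k - V₂ (ρ • (ω : E3)) k) ^ 2
        + radial₁ (fun y => V₁ y k - V₂ y k) ρ ω ^ 2) ∂σ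
      = ∫ ω : S2, ∑ k, (V₁ (ρ • (ω : E3)) k - V₂ (ρ • (ω : E3)) k) ^ 2 ∂σ
        + ∫ ω : S2, ∑ k, fderiv ℝ (fun y => V₁ y k - V₂ y k) (ρ • (ω : E3))
            (ρ⁻¹ • ρ • (ω : E3)) ^ 2 ∂σ := by
    have hm : Continuous fun ω : S2 => ρ • (ω : E3) := by fun_prop
    rw [← integral_finsetSum _ fun k _ => integrable_sphere (continuous_cauchyData (hw k) ρ)]
    refine Eq.trans ?_ (integral_add (integrable_sphere (c₀.comp hm))
        (integrable_sphere (c₁.comp hm)))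
    simp only [radial₁, inv_smul_smul₀ hρ.ne', Finset.sum_add_distrib]
  rw [hsum]
  have t₀ := mul_le_mul_of_nonneg_left h₀ hC.le
  have t₁ := mul_le_mul_of_nonneg_left h₁ hC.le
  linarith

/-- Hölder stability for the Cauchy problem of the quasilinear
elliptic system, Theorem 3.3. Let `Ω = {|x| < ρ} ⊂ ℝ³`, `Ω_μ = {μ < |x| < ρ}`, and let
`V₁, V₂` be two `C¹(Ω̄)`-bounded (by `A`) solutions of `ΔV = F(∇V)` in `Ω` whose Cauchy
data on `S_ρ` differ by at most `δ` in `L²(S_ρ)`.  Fix `η ∈ (0, ρ−μ)`.  Then there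
exist `C₁ > 0` and `δ₀ ∈ (0,1)`, depending only on `Ω_μ`, `η`, `F`, `A`, such that for
all `δ ∈ (0, δ₀)`: `‖V₁ − V₂‖_{H¹(Ω_{μ+η})} ≤ C₁ δ^{η/(4ρ)}`. -/
theorem hoelder_stability_cauchy_problem
    (μ ρ η A : ℝ) (hμ : 0 < μ) (hμρ : μ < ρ) (hη : 0 < η) (hηρ : η < ρ - μ) (hA : 0 < A)
    (N : ℕ) (F : (Fin N → EuclideanSpace ℝ (Fin 3)) → (Fin N → ℝ))
    (hF : IsQuadratic N F) :
    ∃ C₁ : ℝ, 0 < C₁ ∧ ∃ δ₀ ∈ Set.Ioo (0:ℝ) 1, ∀ δ ∈ Set.Ioo (0:ℝ) δ₀,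
      ∀ V₁ V₂ : EuclideanSpace ℝ (Fin 3) → (Fin N → ℝ),
      (∀ k, ContDiff ℝ 2 (fun y => V₁ y k)) →
      (∀ k, ContDiff ℝ 2 (fun y => V₂ y k)) →
      -- `C¹(Ω̄)` bounds by `A`
      (∀ x ∈ closure (Metric.ball (0 : EuclideanSpace ℝ (Fin 3)) ρ), ∀ k,
        |V₁ x k| + ‖gradient (fun y => V₁ y k) x‖ ≤ A) →
      (∀ x ∈ closure (Metric.ball (0 : EuclideanSpace ℝ (Fin 3)) ρ), ∀ k,
        |V₂ x k| + ‖gradient (fun y => V₂ y k) x‖ ≤ A) →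
      -- both solve `ΔV = F(∇V)` in `Ω`
      (∀ x ∈ Metric.ball (0 : EuclideanSpace ℝ (Fin 3)) ρ,
        (fun k => lap (fun y => V₁ y k) x) = F (fun k => gradient (fun y => V₁ y k) x)) →
      (∀ x ∈ Metric.ball (0 : EuclideanSpace ℝ (Fin 3)) ρ,
        (fun k => lap (fun y => V₂ y k) x) = F (fun k => gradient (fun y => V₂ y k) x)) →
      -- the Dirichlet Cauchy data on `S_ρ` differ by at most `δ` in `L²(S_ρ)`
      (∫ x in Metric.sphere (0 : EuclideanSpace ℝ (Fin 3)) ρ,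
          ∑ k, (V₁ x k - V₂ x k) ^ 2 ∂(μH[2])) ≤ δ ^ 2 →
      -- the Neumann Cauchy data on `S_ρ` differ by at most `δ` in `L²(S_ρ)`
      (∫ x in Metric.sphere (0 : EuclideanSpace ℝ (Fin 3)) ρ,
          ∑ k, (radialDeriv (fun y => V₁ y k) x - radialDeriv (fun y => V₂ y k) x) ^ 2
          ∂(μH[2])) ≤ δ ^ 2 →
      Real.sqrt (∫ x in annulus (μ + η) ρ,
          ∑ k, ((V₁ x k - V₂ x k) ^ 2
            + ‖gradient (fun y => V₁ y k - V₂ y k) x‖ ^ 2))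
        ≤ C₁ * δ ^ (η / (4 * ρ)) := by
  have hρ : 0 < ρ := hμ.trans hμρ
  obtain ⟨K, hK, hLip⟩ := hF.exists_sum_sq_sub_le hA.le
  obtain ⟨C, hC, hdata⟩ := exists_sum_integral_cauchyData_le hρ
  set M : ℝ := N * ((2 * A) ^ 2 * (σ).real Set.univ) with hM
  have hM0 : 0 ≤ M := by positivity
  set D : ℝ := 2 * ρ ^ 2 * M + 72 * ρ ^ 2 * C with hD
  have hD0 : 0 < D := by positivity
  set L : ℝ := 1 + 2 / ρ + 1 / μ + 6 * ρ * (2 * K + 1) with hL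
  have hL1 : 0 < 2 / ρ := by positivity
  have hL2 : 0 < 1 / μ := by positivity
  have hL3 : 0 < 6 * ρ * (2 * K + 1) := by positivity
  refine ⟨√(D * (6 / η ^ 3)), by positivity, exp (-(2 * ρ * L)), ⟨exp_pos _, ?_⟩, ?_⟩
  · have : 0 < 2 * ρ * L := by positivity
    simpa using this
  intro δ hδ V₁ V₂ hV₁ hV₂ hA₁ hA₂ hp₁ hp₂ hd₀ hd₁
  have hδ0 : 0 < δ := hδ.1
  set w : Fin N → EuclideanSpace ℝ (Fin 3) → ℝ := fun k y => V₁ y k - V₂ y k with hwdef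
  have hw : ∀ k, ContDiff ℝ 2 (w k) := fun k => (hV₁ k).sub (hV₂ k)
  obtain ⟨l, hlδ⟩ : ∃ l, log δ = -(2 * l * ρ) := ⟨-log δ / (2 * ρ), by field_simp⟩
  have hδl : δ = exp (-(2 * l * ρ)) := by rw [← hlδ, exp_log hδ0]
  have hLl : L < l := by
    have := (log_lt_iff_lt_exp hδ0).2 hδ.2
    rw [hlδ] at this
    nlinarith
  have hcl : ∀ x : EuclideanSpace ℝ (Fin 3), ‖x‖ ≤ ρ → x ∈ closure (Metric.ball 0 ρ) := by
    intro x hx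
    rw [closure_ball _ hρ.ne']
    simpa using hx
  have hg₁ : ∀ x, ‖x‖ ≤ ρ → ∀ k, ‖gradient (fun y => V₁ y k) x‖ ≤ A := fun x hx k =>
    (le_add_of_nonneg_left (abs_nonneg _)).trans (hA₁ x (hcl x hx) k)
  have hg₂ : ∀ x, ‖x‖ ≤ ρ → ∀ k, ‖gradient (fun y => V₂ y k) x‖ ≤ A := fun x hx k =>
    (le_add_of_nonneg_left (abs_nonneg _)).trans (hA₂ x (hcl x hx) k)
  have hgw : ∀ k x, gradient (w k) x = gradient (fun y => V₁ y k) x - gradient (fun y => V₂ y k)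
      x :=
    fun k x => gradient_fun_sub ((hV₁ k).differentiable two_ne_zero x)
      ((hV₂ k).differentiable two_ne_zero x)
  have hlap : ∀ x, ‖x‖ < ρ → ∑ k, lap (w k) x ^ 2 ≤
      K * ∑ k, ∑ j, fderiv ℝ (w k) x (EuclideanSpace.single j 1) ^ 2 := by
    intro x hx
    have hxb : x ∈ Metric.ball (0 : EuclideanSpace ℝ (Fin 3)) ρ := by simpa using hx
    have h := hLip _ _ (hg₁ x hx.le) (hg₂ x hx.le)
    rw [← hp₁ x hxb, ← hp₂ x hxb] at h
    simp only [← norm_gradient_sq, hgw]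
    simpa only [hwdef, lap_fun_sub (hV₁ _) (hV₂ _)] using h
  have hT := sum_integral_tangentialSq_le hw (A := 2 * A) hμ.le fun k x hx => by
    rw [hgw]
    exact (norm_sub_le _ _).trans
      ((add_le_add (hg₁ x (hx.trans hμρ.le) k) (hg₂ x (hx.trans hμρ.le) k)).trans_eq (by ring))
  have hB := hdata N V₁ V₂ δ hV₁ hV₂ hd₀ hd₁
  have key := integral_annulus_sobolevDensity_le hw (η := η) (l := l) hμ hη (by linarith) hK
    (by linarith) (by linarith) (by linarith) (by linarith) hlap
  have hl0 : 0 ≤ l := by linarith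
  have hδη : δ ≤ exp (-(2 * l * η)) := by
    rw [hδl]
    gcongr
    linarith
  have hbound : ∫ x in annulus (μ + η) ρ, sobolevDensity w x ≤ D * (6 / η ^ 3) * exp (-(l * η)) :=
      by
    calc _ ≤ _ := key
      _ ≤ l ^ 3 * (2 * ρ ^ 2 * exp (-(2 * l * η)) * M
            + 36 * ρ ^ 2 * exp (2 * l * ρ) * (2 * C * δ ^ 2)) := by gcongr
      _ = l ^ 3 * (2 * ρ ^ 2 * exp (-(2 * l * η)) * M + 72 * ρ ^ 2 * C * δ) := by
          have : exp (2 * l * ρ) * δ = 1 := by rw [hδl, ← exp_add]; simp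
          linear_combination (l ^ 3 * 72 * ρ ^ 2 * C * δ) * this
      _ ≤ l ^ 3 * (2 * ρ ^ 2 * exp (-(2 * l * η)) * M + 72 * ρ ^ 2 * C * exp (-(2 * l * η))) := by
          gcongr
      _ = D * (l ^ 3 * exp (-(2 * l * η))) := by rw [hD]; ring
      _ ≤ D * (6 / η ^ 3 * exp (-(l * η))) :=
          mul_le_mul_of_nonneg_left (pow_three_mul_exp_neg_le hη hl0) hD0.le
      _ = _ := by ring
  have hpow : δ ^ (η / (4 * ρ)) = √(exp (-(l * η))) := by
    rw [rpow_def_of_pos hδ0, hlδ, ← exp_half]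
    congr 1
    field_simp
    ring
  rw [hpow, ← sqrt_mul (by positivity)]
  refine sqrt_le_sqrt (le_of_eq_of_le ?_ hbound)
  simp only [sobolevDensity, ← norm_gradient_sq, hwdef]
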